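/- Let f_θ : ℝ^D → ℝ^O be a fully-connected network of depth L in the ReLU-MLP setting with hidden width n, with initialization θ = θ₀ and corresponding function f₀. Let 𝒟 be a finite training set of N inputs with one-hot label matrix 𝒴_𝒟, and x a test input, all in a compact set. Define the linearized predictor f^lin(x) = f₀(x) + Θ₀(x,𝒟) Θ₀(𝒟,𝒟)^{−1} (𝒴_𝒟 − f₀(𝒟)) using the empirical NTK, and the pseudo-linearized predictor f̂^lin(x) = f₀(x) + Θ̂₀(x,𝒟) Θ̂₀(𝒟,𝒟)^{−1} (𝒴_𝒟 − f₀(𝒟)) using the pseudo-NTK (with 𝒴_𝒟 − f₀(𝒟) reshaped as an N×O matrix). Then for every δ > 0 there exist n₀ and a constant C such that for all n > n₀, with probability at least 1 − δ over the random initialization, after proper reshaping ‖f̂^lin(x) − f^lin(x)‖_F ≤ C·n^{−1/2}. -/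

import Mathlib

open MeasureTheory ProbabilityTheory

noncomputable section

/-- The ReLU activation. -/
def relu (t : ℝ) : ℝ := max t 0

/-- Parameter space of an `L`-layer fully-connected network with widths `w`:
`w 0` is the input dimension and `w L` the output dimension. -/
abbrev Params (L : ℕ) (w : ℕ → ℕ) : Type :=
  (l : Fin L) → Fin (w (l.val + 1)) → Fin (w l.val) → ℝ

/-- Extend a finite family of weight matrices to all layer indices (zero beyond `L`). -/
def extParams {L : ℕ} {w : ℕ → ℕ} (θ : Params L w) (l : ℕ) :
    Fin (w (l + 1)) → Fin (w l) → ℝ :=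
  if h : l < L then θ ⟨l, h⟩ else 0

/-- Post-activations of layer `l` (ReLU applied coordinatewise); `layerOut w θ 0 x = x`. -/
def layerOut (w : ℕ → ℕ) (θ : (l : ℕ) → Fin (w (l + 1)) → Fin (w l) → ℝ) :
    (l : ℕ) → (Fin (w 0) → ℝ) → Fin (w l) → ℝ
  | 0, x => x
  | l + 1, x => fun i => relu (∑ j, θ l i j * layerOut w θ l x j)

/-- Network output: a linear read-out layer on top of `L - 1` ReLU layers. -/
def netOut (w : ℕ → ℕ) (θ : (l : ℕ) → Fin (w (l + 1)) → Fin (w l) → ℝ) :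
    (L : ℕ) → (Fin (w 0) → ℝ) → Fin (w L) → ℝ
  | 0, x => x
  | L + 1, x => fun i => ∑ j, θ L i j * layerOut w θ L x j

/-- The fully-connected network, as a function of its parameters. -/
def fnet (L : ℕ) (w : ℕ → ℕ) (θ : Params L w) (x : Fin (w 0) → ℝ) : Fin (w L) → ℝ :=
  netOut w (extParams θ) L x

/-- Partial derivative of a scalar function of the parameters with respect to the
weight with coordinates `(l, i, j)` (defined via the Fréchet derivative, which exists
almost surely for the networks considered here). -/
def pderiv {L : ℕ} {w : ℕ → ℕ} (F : Params L w → ℝ) (θ : Params L w)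
    (l : Fin L) (i : Fin (w (l.val + 1))) (j : Fin (w l.val)) : ℝ :=
  fderiv ℝ F θ (Pi.single l (Pi.single i (Pi.single j (1 : ℝ))))

/-- The empirical NTK `Θ_θ(x₁, x₂) = J_θ(f_θ(x₁)) J_θ(f_θ(x₂))ᵀ ∈ ℝ^{O×O}`. -/
def eNTK (L : ℕ) (w : ℕ → ℕ) (θ : Params L w) (x₁ x₂ : Fin (w 0) → ℝ) :
    Matrix (Fin (w L)) (Fin (w L)) ℝ := fun i₁ i₂ =>
  ∑ l : Fin L, ∑ a : Fin (w (l.val + 1)), ∑ b : Fin (w l.val),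
    pderiv (fun θ' => fnet L w θ' x₁ i₁) θ l a b *
      pderiv (fun θ' => fnet L w θ' x₂ i₂) θ l a b

/-- The pseudo-NTK ("sum of logits"): the scalar kernel
`⟨∇_θ (1/√O) ∑ᵢ f^{(i)}_θ(x₁), ∇_θ (1/√O) ∑ᵢ f^{(i)}_θ(x₂)⟩`. -/
def pNTK (L : ℕ) (w : ℕ → ℕ) (θ : Params L w) (x₁ x₂ : Fin (w 0) → ℝ) : ℝ :=
  ∑ l : Fin L, ∑ a : Fin (w (l.val + 1)), ∑ b : Fin (w l.val),
    pderiv (fun θ' => (Real.sqrt (w L))⁻¹ * ∑ i, fnet L w θ' x₁ i) θ l a b *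
      pderiv (fun θ' => (Real.sqrt (w L))⁻¹ * ∑ i, fnet L w θ' x₂ i) θ l a b

/-- He ("fan-in") initialization: all weights independent, `W^{(l)}_{ij} ~ N(0, 1/n_{l-1})`. -/
def initMeasure (L : ℕ) (w : ℕ → ℕ) : Measure (Params L w) :=
  Measure.pi fun l => Measure.pi fun _ => Measure.pi fun _ =>
    gaussianReal 0 ((w l.val : NNReal))⁻¹

/-- Widths of the ReLU-MLP: input dimension `D`, hidden layers of width `n`, output `O`. -/
def widths (D n O L : ℕ) : ℕ → ℕ
  | 0 => D
  | l + 1 => if l + 1 < L then n else O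

/-- Frobenius norm of a real matrix. -/
def frobNorm {m k : Type*} [Fintype m] [Fintype k] (M : Matrix m k ℝ) : ℝ :=
  Real.sqrt (∑ i, ∑ j, (M i j) ^ 2)

/-- Isotropic centred Gaussian vector with coordinate variance `v`. -/
abbrev gaussVec (ι : Type*) [Fintype ι] (v : NNReal) : Measure (ι → ℝ) :=
  Measure.pi fun _ : ι => gaussianReal 0 v

section GaussVec

variable {ι κ : Type*} [Fintype ι] [Fintype κ]

lemma gaussVec_map_dot (v : NNReal) (a : ι → ℝ) :
    (gaussVec ι v).map (fun w => ∑ j, w j * a j) =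
      gaussianReal 0 (v * Real.toNNReal (∑ j, a j ^ 2)) := by
  have hm : Measurable fun w : ι → ℝ => ∑ j, w j * a j := by fun_prop
  have : IsProbabilityMeasure ((gaussVec ι v).map (fun w => ∑ j, w j * a j)) :=
    Measure.isProbabilityMeasure_map hm.aemeasurable
  refine Measure.ext_of_charFun ?_
  ext t
  rw [charFun_gaussianReal, charFun_apply_real, integral_map hm.aemeasurable (by fun_prop)]
  have h1 : ∀ w : ι → ℝ, Complex.exp (t * (∑ j, w j * a j : ℝ) * Complex.I) =
      ∏ j, Complex.exp ((t * a j : ℝ) * (w j) * Complex.I) := by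
    intro w
    rw [← Complex.exp_sum]
    congr 1
    push_cast
    rw [Finset.mul_sum, Finset.sum_mul]
    exact Finset.sum_congr rfl fun j _ => by ring
  simp_rw [h1]
  rw [integral_fintype_prod_eq_prod
    (f := fun j (x : ℝ) => Complex.exp ((t * a j : ℝ) * (x) * Complex.I))]
  simp_rw [← charFun_apply_real, charFun_gaussianReal]
  rw [← Complex.exp_sum]
  congr 1
  have : (0 : ℝ) ≤ ∑ j, a j ^ 2 := Finset.sum_nonneg fun j _ => sq_nonneg _
  push_cast
  rw [Real.coe_toNNReal _ this]
  push_cast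
  simp only [mul_zero, zero_mul, zero_sub, Finset.sum_neg_distrib, Finset.mul_sum,
    Finset.sum_mul, Finset.sum_div]
  congr 1
  exact Finset.sum_congr rfl fun j _ => by ring

lemma strongDual_pi_apply (L : StrongDual ℝ (ι → ℝ)) :
    ∃ a : ι → ℝ, ∀ w, L w = ∑ j, w j * a j := by
  classical
  refine ⟨fun j => L (Pi.single j 1), fun w => ?_⟩
  conv_lhs => rw [pi_eq_sum_univ' w, map_sum]
  refine Finset.sum_congr rfl fun j _ => ?_
  rw [map_smul, smul_eq_mul]

instance isGaussian_gaussVec (v : NNReal) : IsGaussian (gaussVec ι v) := by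
  refine isGaussian_of_map_eq_gaussianReal fun L => ?_
  obtain ⟨a, ha⟩ := strongDual_pi_apply L
  refine ⟨0, v * Real.toNNReal (∑ j, a j ^ 2), ?_⟩
  rw [← gaussVec_map_dot v a]
  congr 1
  ext w
  exact ha w

lemma sum_sq_sum_mul (z : κ → ι → ℝ) (c : κ → ℝ) :
    ∑ j, (∑ p, z p j * c p) ^ 2 = ∑ p, ∑ q, c p * c q * ∑ j, z p j * z q j := by
  simp only [sq, Finset.sum_mul_sum]
  rw [Finset.sum_comm]
  refine Finset.sum_congr rfl fun p _ => ?_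
  rw [Finset.sum_comm]
  refine Finset.sum_congr rfl fun q _ => ?_
  rw [Finset.mul_sum]
  exact Finset.sum_congr rfl fun _ _ => by ring

lemma gaussVec_map_linear_congr {ν : Type*} [Fintype ν] (v v' : NNReal) (a : ν → ι → ℝ)
    (b : ν → κ → ℝ)
    (h : ∀ p q, v * ∑ j, a p j * a q j = v' * ∑ j, b p j * b q j) :
    (gaussVec ι v).map (fun w p => ∑ j, w j * a p j) =
      (gaussVec κ v').map (fun w p => ∑ j, w j * b p j) := by
  have hma : Measurable fun (w : ι → ℝ) (p : ν) => ∑ j, w j * a p j := by fun_prop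
  have hmb : Measurable fun (w : κ → ℝ) (p : ν) => ∑ j, w j * b p j := by fun_prop
  have := Measure.isProbabilityMeasure_map (μ := gaussVec ι v) hma.aemeasurable
  have := Measure.isProbabilityMeasure_map (μ := gaussVec κ v') hmb.aemeasurable
  refine Measure.ext_of_charFunDual ?_
  ext L
  obtain ⟨c, hc⟩ := strongDual_pi_apply L
  rw [charFunDual_eq_charFun_map_one, charFunDual_eq_charFun_map_one,
    Measure.map_map (by fun_prop) hma, Measure.map_map (by fun_prop) hmb]
  have ea : (⇑L ∘ fun (w : ι → ℝ) (p : ν) => ∑ j, w j * a p j) =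
      fun w => ∑ j, w j * ∑ p, a p j * c p := by
    ext w
    simp only [Function.comp, hc, Finset.sum_mul, Finset.mul_sum]
    rw [Finset.sum_comm]
    exact Finset.sum_congr rfl fun _ _ => Finset.sum_congr rfl fun _ _ => by ring
  have eb : (⇑L ∘ fun (w : κ → ℝ) (p : ν) => ∑ j, w j * b p j) =
      fun w => ∑ j, w j * ∑ p, b p j * c p := by
    ext w
    simp only [Function.comp, hc, Finset.sum_mul, Finset.mul_sum]
    rw [Finset.sum_comm]
    exact Finset.sum_congr rfl fun _ _ => Finset.sum_congr rfl fun _ _ => by ring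
  rw [ea, eb, gaussVec_map_dot, gaussVec_map_dot]
  congr 2
  ext
  push_cast
  rw [Real.coe_toNNReal _ (Finset.sum_nonneg fun j _ => sq_nonneg _),
    Real.coe_toNNReal _ (Finset.sum_nonneg fun j _ => sq_nonneg _), sum_sq_sum_mul, sum_sq_sum_mul]
  simp only [Finset.mul_sum (s := Finset.univ) (a := (v : ℝ)),
    Finset.mul_sum (s := Finset.univ) (a := (v' : ℝ))] at h ⊢
  refine Finset.sum_congr rfl fun p _ => Finset.sum_congr rfl fun q _ => ?_
  have := h p q
  rw [← Finset.mul_sum, ← Finset.mul_sum] at this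
  linear_combination (c p * c q) * this

lemma gaussVec_hyperplane_null {v : NNReal} (hv : v ≠ 0) {a : ι → ℝ} (ha : a ≠ 0) :
    gaussVec ι v {w | ∑ j, w j * a j = 0} = 0 := by
  have hm : Measurable fun w : ι → ℝ => ∑ j, w j * a j := by fun_prop
  have : {w : ι → ℝ | ∑ j, w j * a j = 0} = (fun w => ∑ j, w j * a j) ⁻¹' {0} := rfl
  rw [this, ← Measure.map_apply hm (measurableSet_singleton _), gaussVec_map_dot]
  have hpos : 0 < ∑ j, a j ^ 2 := by
    obtain ⟨j, hj⟩ := Function.ne_iff.mp ha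
    exact Finset.sum_pos' (fun _ _ => sq_nonneg _) ⟨j, Finset.mem_univ _, by
      have : a j ≠ 0 := hj
      positivity⟩
  have := nullSingletonClass_gaussianReal (μ := 0) (v := v * Real.toNNReal (∑ j, a j ^ 2))
    (mul_ne_zero hv (by simpa using hpos))
  exact measure_singleton _

/-- The fourth moment of the standard Gaussian. -/
def gaussFourth : ℝ := ∫ z, z ^ 4 ∂(gaussianReal 0 1)

lemma gaussFourth_nonneg : 0 ≤ gaussFourth := integral_nonneg fun z => by positivity

lemma gaussianReal_eq_map_std (v : NNReal) :
    gaussianReal 0 v = (gaussianReal 0 1).map (fun z => Real.sqrt v * z) := by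
  rw [gaussianReal_map_const_mul]
  congr 1
  · simp
  · ext
    simp

lemma lintegral_gaussianReal_sq (v : NNReal) :
    ∫⁻ z, ENNReal.ofReal (z ^ 2) ∂(gaussianReal 0 v) = ENNReal.ofReal v := by
  have h := memLp_id_gaussianReal (μ := 0) (v := v) 2
  rw [← ofReal_integral_eq_lintegral_ofReal]
  · congr 1
    have := variance_id_gaussianReal (μ := 0) (v := v)
    rw [variance_eq_sub (by exact_mod_cast h)] at this
    simpa using this
  · exact (by exact_mod_cast h : MemLp id 2 (gaussianReal 0 v)).integrable_sq
  · exact Filter.Eventually.of_forall fun z => sq_nonneg z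

lemma integrable_pow_gaussianReal (v : NNReal) (k : ℕ) :
    Integrable (fun z => z ^ k) (gaussianReal 0 v) := by
  have h := memLp_id_gaussianReal (μ := 0) (v := v) k
  have := (by exact_mod_cast h : MemLp id k (gaussianReal 0 v)).integrable_norm_pow'
  rw [← integrable_norm_iff (by fun_prop)]
  simpa [norm_pow] using this

lemma lintegral_gaussianReal_pow_four (v : NNReal) :
    ∫⁻ z, ENNReal.ofReal (z ^ 4) ∂(gaussianReal 0 v) =
      ENNReal.ofReal (gaussFourth * v ^ 2) := by
  rw [gaussianReal_eq_map_std, lintegral_map (by fun_prop) (by fun_prop)]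
  simp_rw [mul_pow]
  rw [← ofReal_integral_eq_lintegral_ofReal]
  · rw [integral_const_mul, gaussFourth, mul_comm]
    congr 2
    have := Real.sq_sqrt v.2
    rw [show (4 : ℕ) = 2 * 2 from rfl, pow_mul]
    exact congrArg (· ^ 2) this
  · exact (integrable_pow_gaussianReal 1 4).const_mul _
  · exact Filter.Eventually.of_forall fun z => by positivity

lemma lintegral_gaussVec_dot_sq (v : NNReal) (a : ι → ℝ) :
    ∫⁻ w, ENNReal.ofReal ((∑ j, w j * a j) ^ 2) ∂(gaussVec ι v) =
      ENNReal.ofReal (v * ∑ j, a j ^ 2) := by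
  have hm : Measurable fun w : ι → ℝ => ∑ j, w j * a j := by fun_prop
  rw [← lintegral_map (f := fun z => ENNReal.ofReal (z ^ 2)) (by fun_prop) hm, gaussVec_map_dot,
    lintegral_gaussianReal_sq]
  congr 1
  push_cast
  rw [Real.coe_toNNReal _ (Finset.sum_nonneg fun j _ => sq_nonneg _)]

lemma lintegral_gaussVec_dot_pow_four (v : NNReal) (a : ι → ℝ) :
    ∫⁻ w, ENNReal.ofReal ((∑ j, w j * a j) ^ 4) ∂(gaussVec ι v) =
      ENNReal.ofReal (gaussFourth * (v * ∑ j, a j ^ 2) ^ 2) := by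
  have hm : Measurable fun w : ι → ℝ => ∑ j, w j * a j := by fun_prop
  rw [← lintegral_map (f := fun z => ENNReal.ofReal (z ^ 4)) (by fun_prop) hm, gaussVec_map_dot,
    lintegral_gaussianReal_pow_four]
  congr 2
  push_cast
  rw [Real.coe_toNNReal _ (Finset.sum_nonneg fun j _ => sq_nonneg _)]

lemma lintegral_gaussVec_dot_sq_mul_dot_sq_le (v : NNReal) (a b : ι → ℝ) :
    ∫⁻ w, ENNReal.ofReal ((∑ j, w j * a j) ^ 2 * (∑ j, w j * b j) ^ 2) ∂(gaussVec ι v) ≤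
      ENNReal.ofReal (gaussFourth * v ^ 2 * ((∑ j, a j ^ 2) * ∑ j, b j ^ 2)) := by
  have hA0 : 0 ≤ ∑ j, a j ^ 2 := Finset.sum_nonneg fun j _ => sq_nonneg _
  have hB0 : 0 ≤ ∑ j, b j ^ 2 := Finset.sum_nonneg fun j _ => sq_nonneg _
  set A := ∑ j, a j ^ 2 with hA
  set B := ∑ j, b j ^ 2 with hB
  have dot_zero : ∀ c : ι → ℝ, ∑ j, c j ^ 2 = 0 → ∀ w : ι → ℝ, ∑ j, w j * c j = 0 := by
    intro c hc w
    rw [Finset.sum_eq_zero_iff_of_nonneg fun _ _ => sq_nonneg _] at hc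
    exact Finset.sum_eq_zero fun j hj => by
      rw [pow_eq_zero_iff two_ne_zero |>.mp (hc j hj), mul_zero]
  rcases hA0.eq_or_lt with h0 | hApos
  · simp [dot_zero a (hA ▸ h0.symm)]
  rcases hB0.eq_or_lt with h0 | hBpos
  · simp [dot_zero b (hB ▸ h0.symm)]
  have hg := gaussFourth_nonneg
  calc _ ≤ ∫⁻ w, (ENNReal.ofReal (B / (2 * A)) * ENNReal.ofReal ((∑ j, w j * a j) ^ 4) +
        ENNReal.ofReal (A / (2 * B)) * ENNReal.ofReal ((∑ j, w j * b j) ^ 4)) ∂(gaussVec ι v) := by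
        refine lintegral_mono fun w => ?_
        simp only
        rw [← ENNReal.ofReal_mul (by positivity), ← ENNReal.ofReal_mul (by positivity),
          ← ENNReal.ofReal_add (by positivity) (by positivity)]
        refine ENNReal.ofReal_le_ofReal ?_
        generalize ∑ j, w j * a j = x
        generalize ∑ j, w j * b j = y
        have : B / (2 * A) * x ^ 4 + A / (2 * B) * y ^ 4 - x ^ 2 * y ^ 2 =
            (B * x ^ 2 - A * y ^ 2) ^ 2 / (2 * A * B) := by
          field_simp
          ring
        have h2 : 0 ≤ (B * x ^ 2 - A * y ^ 2) ^ 2 / (2 * A * B) := by positivity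
        linarith
    _ = _ := by
        rw [lintegral_add_left (by fun_prop), lintegral_const_mul _ (by fun_prop),
          lintegral_const_mul _ (by fun_prop), lintegral_gaussVec_dot_pow_four,
          lintegral_gaussVec_dot_pow_four, ← ENNReal.ofReal_mul (by positivity),
          ← ENNReal.ofReal_mul (by positivity),
          ← ENNReal.ofReal_add (by positivity) (by positivity), ← hA, ← hB]
        congr 1
        field_simp
        ring

lemma lintegral_gaussVec_bilin_sq (v : NNReal) (G : ι → κ → ℝ) :
    ∫⁻ y, ∫⁻ x, ENNReal.ofReal ((∑ j, ∑ k, x j * y k * G j k) ^ 2) ∂(gaussVec ι v)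
        ∂(gaussVec κ v) =
      ENNReal.ofReal (v ^ 2 * ∑ j, ∑ k, G j k ^ 2) := by
  have e : ∀ (x : ι → ℝ) (y : κ → ℝ), ∑ j, ∑ k, x j * y k * G j k =
      ∑ j, x j * ∑ k, y k * G j k := fun x y => by
    simp only [Finset.mul_sum, mul_assoc]
  simp_rw [e, lintegral_gaussVec_dot_sq, Finset.mul_sum]
  have e2 : ∀ y : κ → ℝ, ENNReal.ofReal (∑ j, v * (∑ k, y k * G j k) ^ 2) =
      ∑ j, ENNReal.ofReal v * ENNReal.ofReal ((∑ k, y k * G j k) ^ 2) := fun y => by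
    rw [ENNReal.ofReal_sum_of_nonneg fun _ _ => by positivity]
    exact Finset.sum_congr rfl fun j _ => ENNReal.ofReal_mul (by positivity)
  simp_rw [e2]
  rw [lintegral_finsetSum _ fun j _ => by fun_prop,
    ENNReal.ofReal_sum_of_nonneg fun _ _ => Finset.sum_nonneg fun _ _ => by positivity]
  refine Finset.sum_congr rfl fun j _ => ?_
  rw [lintegral_const_mul _ (by fun_prop), lintegral_gaussVec_dot_sq,
    ← ENNReal.ofReal_mul (by positivity), ← Finset.mul_sum]
  congr 1
  ring

lemma lintegral_gaussVec_quad_sq_le (v : NNReal) (G : ι → ι → ℝ) :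
    ∫⁻ x, ENNReal.ofReal ((∑ j, ∑ k, x j * x k * G j k) ^ 2) ∂(gaussVec ι v) ≤
      ENNReal.ofReal (gaussFourth * v ^ 2 * (Fintype.card ι * ∑ j, ∑ k, G j k ^ 2)) := by
  classical
  have hg := gaussFourth_nonneg
  have e : ∀ x : ι → ℝ, (∑ j, ∑ k, x j * x k * G j k) ^ 2 ≤
      ∑ i, ∑ j, (∑ l, x l * (if l = i then 1 else 0)) ^ 2 * (∑ k, x k * G j k) ^ 2 := by
    intro x
    have : ∑ j, ∑ k, x j * x k * G j k = ∑ j, x j * ∑ k, x k * G j k := by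
      simp only [Finset.mul_sum, mul_assoc]
    rw [this]
    refine (Finset.sum_mul_sq_le_sq_mul_sq _ _ _).trans (le_of_eq ?_)
    simp [Finset.sum_mul_sum]
  calc _ ≤ ∫⁻ x, ∑ i, ∑ j, ENNReal.ofReal ((∑ l, x l * (if l = i then 1 else 0)) ^ 2 *
          (∑ k, x k * G j k) ^ 2) ∂(gaussVec ι v) := by
        refine lintegral_mono fun x => (ENNReal.ofReal_le_ofReal (e x)).trans (le_of_eq ?_)
        rw [ENNReal.ofReal_sum_of_nonneg fun _ _ => Finset.sum_nonneg fun _ _ => by positivity]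
        exact Finset.sum_congr rfl fun _ _ =>
          ENNReal.ofReal_sum_of_nonneg fun _ _ => by positivity
    _ ≤ ∑ i : ι, ∑ j, ENNReal.ofReal (gaussFourth * v ^ 2 * (1 * ∑ k, G j k ^ 2)) := by
        rw [lintegral_finsetSum _ fun j _ => by fun_prop]
        refine Finset.sum_le_sum fun i _ => ?_
        rw [lintegral_finsetSum _ fun j _ => by fun_prop]
        refine Finset.sum_le_sum fun j _ => ?_
        refine (lintegral_gaussVec_dot_sq_mul_dot_sq_le v _ _).trans (le_of_eq ?_)
        simp
    _ = _ := by
        simp only [one_mul]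
        rw [← ENNReal.ofReal_sum_of_nonneg fun _ _ => by positivity, Finset.sum_const,
          Finset.card_univ, nsmul_eq_mul, ← ENNReal.ofReal_natCast,
          ← ENNReal.ofReal_mul (by positivity), ← Finset.mul_sum]
        congr 1
        ring

lemma lintegral_gaussVec_rotation (v : NNReal) (F : (ι → ℝ) → (ι → ℝ) → ENNReal)
    (hF : Measurable (Function.uncurry F)) :
    ∫⁻ x, ∫⁻ y, F x y ∂(gaussVec ι v) ∂(gaussVec ι v) =
      ∫⁻ x, ∫⁻ y, F ((Real.sqrt 2)⁻¹ • (x + y)) ((Real.sqrt 2)⁻¹ • (y - x)) ∂(gaussVec ι v)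
        ∂(gaussVec ι v) := by
  have h0 : ∀ L : StrongDual ℝ (ι → ℝ), (gaussVec ι v)[L] = 0 := by
    intro L
    obtain ⟨a, ha⟩ := strongDual_pi_apply L
    have hm : Measurable fun w : ι → ℝ => ∑ j, w j * a j := by fun_prop
    simp_rw [ha]
    have := integral_map (μ := gaussVec ι v) hm.aemeasurable (f := id) (by fun_prop)
    simp only [id] at this
    rw [← this, gaussVec_map_dot, integral_id_gaussianReal]
  have hr := IsGaussian.map_rotation_eq_self_of_forall_strongDual_eq_zero h0 (Real.pi / 4)
  have hc : (Real.sqrt 2) / 2 = (Real.sqrt 2)⁻¹ := by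
    rw [div_eq_iff (by norm_num)]
    have h2 : Real.sqrt 2 * Real.sqrt 2 = 2 := Real.mul_self_sqrt (by norm_num)
    field_simp
    linarith
  rw [lintegral_lintegral (f := F) hF.aemeasurable]
  change ∫⁻ z, Function.uncurry F z ∂_ = _
  conv_lhs => rw [← hr]
  rw [lintegral_map hF (by fun_prop), lintegral_prod _ (by fun_prop)]
  refine lintegral_congr fun x => lintegral_congr fun y => ?_
  simp [ContinuousLinearMap.rotation_apply, Function.uncurry, Real.cos_pi_div_four,
    Real.sin_pi_div_four, hc, smul_add, sub_eq_add_neg, add_comm]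

lemma lintegral_gaussVec_quad_diff_sq_le (v : NNReal) (G : ι → ι → ℝ) :
    ∫⁻ x, ∫⁻ y, ENNReal.ofReal ((∑ j, ∑ k, x j * x k * G j k - ∑ j, ∑ k, y j * y k * G j k) ^ 2)
      ∂(gaussVec ι v) ∂(gaussVec ι v) ≤ ENNReal.ofReal (4 * v ^ 2 * ∑ j, ∑ k, G j k ^ 2) := by
  rw [lintegral_gaussVec_rotation v (fun x y => ENNReal.ofReal
    ((∑ j, ∑ k, x j * x k * G j k - ∑ j, ∑ k, y j * y k * G j k) ^ 2))
    (by unfold Function.uncurry; fun_prop)]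
  have hs : (Real.sqrt 2)⁻¹ * (Real.sqrt 2)⁻¹ = 1 / 2 := by
    rw [← mul_inv, Real.mul_self_sqrt (by norm_num)]; norm_num
  have e : ∀ x y : ι → ℝ, ENNReal.ofReal ((∑ j, ∑ k, ((Real.sqrt 2)⁻¹ • (x + y)) j *
      ((Real.sqrt 2)⁻¹ • (x + y)) k * G j k - ∑ j, ∑ k, ((Real.sqrt 2)⁻¹ • (y - x)) j *
      ((Real.sqrt 2)⁻¹ • (y - x)) k * G j k) ^ 2) ≤
      ENNReal.ofReal 2 * ENNReal.ofReal ((∑ j, ∑ k, x j * y k * G j k) ^ 2) +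
        ENNReal.ofReal 2 * ENNReal.ofReal ((∑ j, ∑ k, x j * y k * G k j) ^ 2) := by
    intro x y
    rw [← ENNReal.ofReal_mul (by positivity), ← ENNReal.ofReal_mul (by positivity),
      ← ENNReal.ofReal_add (by positivity) (by positivity)]
    refine ENNReal.ofReal_le_ofReal ?_
    have : (∑ j, ∑ k, ((Real.sqrt 2)⁻¹ • (x + y)) j *
      ((Real.sqrt 2)⁻¹ • (x + y)) k * G j k - ∑ j, ∑ k, ((Real.sqrt 2)⁻¹ • (y - x)) j *
      ((Real.sqrt 2)⁻¹ • (y - x)) k * G j k) = ∑ j, ∑ k, x j * y k * G j k +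
        ∑ j, ∑ k, x j * y k * G k j := by
      rw [Finset.sum_comm (f := fun j k => x j * y k * G k j)]
      simp only [← Finset.sum_sub_distrib, ← Finset.sum_add_distrib]
      refine Finset.sum_congr rfl fun j _ => Finset.sum_congr rfl fun k _ => ?_
      simp only [Pi.smul_apply, Pi.add_apply, Pi.sub_apply, smul_eq_mul]
      linear_combination (2 * (x j * y k * G j k) + 2 * (x k * y j * G j k)) * hs
    rw [this]
    nlinarith [sq_nonneg (∑ j, ∑ k, x j * y k * G j k - ∑ j, ∑ k, x j * y k * G k j)]
  refine (lintegral_mono fun x => lintegral_mono fun y => e x y).trans ?_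
  rw [lintegral_lintegral_swap (by unfold Function.uncurry; fun_prop)]
  have s : ∀ y : ι → ℝ, ∫⁻ x,
      (ENNReal.ofReal 2 * ENNReal.ofReal ((∑ j, ∑ k, x j * y k * G j k) ^ 2) +
        ENNReal.ofReal 2 * ENNReal.ofReal ((∑ j, ∑ k, x j * y k * G k j) ^ 2)) ∂(gaussVec ι v) =
      ENNReal.ofReal 2 * ∫⁻ x, ENNReal.ofReal ((∑ j, ∑ k, x j * y k * G j k) ^ 2) ∂(gaussVec ι v) +
      ENNReal.ofReal 2 * ∫⁻ x, ENNReal.ofReal ((∑ j, ∑ k, x j * y k * G k j) ^ 2)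
        ∂(gaussVec ι v) := fun y => by
    rw [lintegral_add_left (by fun_prop), lintegral_const_mul _ (by fun_prop),
      lintegral_const_mul _ (by fun_prop)]
  have hms : ∀ H : ι → ι → ℝ, Measurable fun y : ι → ℝ =>
      ∫⁻ x, ENNReal.ofReal ((∑ j, ∑ k, x j * y k * H j k) ^ 2) ∂(gaussVec ι v) := fun H =>
    Measurable.lintegral_prod_right' (f := fun p : (ι → ℝ) × (ι → ℝ) =>
      ENNReal.ofReal ((∑ j, ∑ k, p.2 j * p.1 k * H j k) ^ 2)) (by fun_prop)
  simp_rw [s]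
  rw [lintegral_add_left ((hms G).const_mul _), lintegral_const_mul _ (hms G),
    lintegral_const_mul _ (hms fun j k => G k j), lintegral_gaussVec_bilin_sq,
    lintegral_gaussVec_bilin_sq v (fun j k => G k j), Finset.sum_comm (f := fun j k => G k j ^ 2),
    ← ENNReal.ofReal_mul (by positivity), ← ENNReal.ofReal_add (by positivity) (by positivity)]
  refine ENNReal.ofReal_le_ofReal (le_of_eq ?_)
  ring

end GaussVec

lemma continuous_relu : Continuous relu := continuous_id.max continuous_const

lemma relu_nonneg (t : ℝ) : 0 ≤ relu t := le_max_right _ _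

lemma abs_relu_le (t : ℝ) : |relu t| ≤ |t| := by
  rw [abs_of_nonneg (relu_nonneg t)]
  exact max_le (le_abs_self t) (abs_nonneg t)

lemma relu_sq_le (t : ℝ) : relu t ^ 2 ≤ t ^ 2 := sq_le_sq.mpr (abs_relu_le t)

lemma relu_mul_of_nonneg {c : ℝ} (hc : 0 ≤ c) (t : ℝ) : relu (c * t) = c * relu t := by
  simp [relu, mul_max_of_nonneg _ _ hc]

lemma relu_add_add_relu_sub {s u : ℝ} (h : |u| ≤ |s|) :
    relu (s + u) + relu (s - u) = 2 * relu s := by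
  unfold relu
  rcases abs_le.mp h with ⟨h1, h2⟩
  rcases le_total 0 s with hs | hs
  · rw [abs_of_nonneg hs] at h1 h2
    rw [max_eq_left (by linarith), max_eq_left (by linarith), max_eq_left hs]
    ring
  · rw [abs_of_nonpos hs] at h1 h2
    rw [max_eq_right (by linarith), max_eq_right (by linarith), max_eq_right hs]
    ring

/-- A coefficient vector with at most `s` nonzero entries. -/
def Sparse {ν : Type*} (s : ℕ) (c : ν → ℝ) : Prop :=
  ∃ T : Finset ν, T.card ≤ s ∧ ∀ p ∉ T, c p = 0

section Relu

variable {ι ν : Type*}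

lemma Sparse.smul {s : ℕ} {c : ν → ℝ} (h : Sparse s c) (t : ℝ) : Sparse s (t • c) := by
  obtain ⟨T, hT, h⟩ := h
  exact ⟨T, hT, fun p hp => by simp [h p hp]⟩

lemma sparse_two_pair [DecidableEq ν] (p q : ν) (x y : ℝ) :
    Sparse 2 (Pi.single p x + Pi.single q y : ν → ℝ) := by
  refine ⟨{p, q}, Finset.card_le_two, fun r hr => ?_⟩
  simp only [Finset.mem_insert, Finset.mem_singleton, not_or] at hr
  simp [hr.1, hr.2]

variable [Fintype ι] [Fintype ν]

lemma sparse_card (c : ν → ℝ) : Sparse (Fintype.card ν) c :=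
  ⟨Finset.univ, le_rfl, fun p hp => absurd (Finset.mem_univ p) hp⟩

lemma isClosed_sparse (s : ℕ) : IsClosed {c : ν → ℝ | Sparse s c} := by
  have : {c : ν → ℝ | Sparse s c} =
      ⋃ T : {T : Finset ν // T.card ≤ s}, {c | ∀ p ∉ T.1, c p = 0} := by
    ext c
    simp [Sparse]
  rw [this]
  refine isClosed_iUnion_of_finite fun T => ?_
  simp only [Set.ofPred_forall]
  exact isClosed_iInter fun p => isClosed_iInter fun _ =>
    isClosed_eq (continuous_apply p) continuous_const

/-- Ridge functions `relu ⟨g, a p⟩` along pairwise non-collinear directions are linearly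
independent. -/
lemma relu_linearIndependent (a : ν → ι → ℝ)
    (ha : ∀ c : ν → ℝ, Sparse 2 c → (∀ j, ∑ p, c p * a p j = 0) → c = 0)
    (c : ν → ℝ) (hc : ∀ g : ι → ℝ, ∑ p, c p * relu (∑ j, g j * a p j) = 0) : c = 0 := by
  classical
  funext q
  have hq : a q ≠ 0 := by
    intro h
    have := congrFun (ha (Pi.single q 1 + Pi.single q 0) (sparse_two_pair q q 1 0) fun j => by
      simp [Pi.single_apply, h]) q
    simp at this
  have hsq : 0 < ∑ j, a q j ^ 2 := by
    obtain ⟨j, hj⟩ := Function.ne_iff.mp hq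
    have hj : a q j ≠ 0 := hj
    exact Finset.sum_pos' (fun _ _ => sq_nonneg _) ⟨j, Finset.mem_univ _, by positivity⟩
  set S := ∑ j, a q j ^ 2 with hS
  let ip : ν → ℝ := fun p => ∑ j, a q j * a p j
  let b : ν → ι → ℝ := fun p j => a p j - ip p / S * a q j
  have hb : ∀ p, p ≠ q → b p ≠ 0 := by
    intro p hp h
    have := congrFun (ha (Pi.single p 1 + Pi.single q (-(ip p / S)))
      (sparse_two_pair p q _ _) fun j => by
        have := congrFun h j
        simp only [b, Pi.zero_apply] at this
        simp only [Pi.add_apply, Pi.single_apply, add_mul, Finset.sum_add_distrib, ite_mul,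
          zero_mul, Finset.sum_ite_eq', Finset.mem_univ, if_true]
        linarith) p
    simp [hp] at this
  obtain ⟨w, hw⟩ : ∃ w : ι → ℝ, ∀ p, p ≠ q → ∑ j, w j * b p j ≠ 0 := by
    have : ∀ᵐ w ∂(gaussVec ι 1), ∀ p, p ≠ q → ∑ j, w j * b p j ≠ 0 := by
      refine ae_all_iff.mpr fun p => ?_
      by_cases hp : p = q
      · simp [hp]
      · have := gaussVec_hyperplane_null (v := 1) one_ne_zero (hb p hp)
        rw [← compl_mem_ae_iff] at this
        filter_upwards [this] with w hw _ using hw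
    exact this.exists
  let wq := ∑ j, w j * a q j
  let g : ι → ℝ := fun j => w j - wq / S * a q j
  have hdot : ∀ p, ∑ j, g j * a p j = ∑ j, w j * b p j := by
    intro p
    have e1 : ∑ j, g j * a p j = ∑ j, w j * a p j - wq / S * ip p := by
      simp only [g, ip, sub_mul, Finset.sum_sub_distrib, Finset.mul_sum, mul_assoc]
    have e2 : ∑ j, w j * b p j = ∑ j, w j * a p j - ip p / S * wq := by
      simp only [b, wq, mul_sub, Finset.sum_sub_distrib, Finset.mul_sum]
      congr 1
      exact Finset.sum_congr rfl fun _ _ => by ring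
    rw [e1, e2]
    ring
  have hgq : ∑ j, g j * a q j = 0 := by
    have : ∑ j, g j * a q j = wq - wq / S * S := by
      simp only [g, sub_mul, Finset.sum_sub_distrib, mul_assoc]
      rw [← Finset.mul_sum, hS]
      congr 2
      exact Finset.sum_congr rfl fun _ _ => by ring
    rw [this]
    field_simp
    ring
  obtain ⟨t, ht0, ht⟩ : ∃ t : ℝ, 0 < t ∧ ∀ p, p ≠ q → |t * ip p| ≤ |∑ j, g j * a p j| := by
    have : ∀ᶠ t in nhdsWithin (0 : ℝ) (Set.Ioi 0), 0 < t ∧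
        ∀ p, p ≠ q → |t * ip p| ≤ |∑ j, g j * a p j| := by
      refine (eventually_mem_nhdsWithin).and (Filter.eventually_all.mpr fun p => ?_)
      by_cases hp : p = q
      · simp [hp]
      · have hlt : |(0 : ℝ) * ip p| < |∑ j, g j * a p j| := by
          rw [zero_mul, abs_zero, hdot]
          exact abs_pos.mpr (hw p hp)
        have hcont : ContinuousAt (fun t : ℝ => |t * ip p|) 0 := by fun_prop
        filter_upwards [(hcont.eventually (gt_mem_nhds hlt)).filter_mono nhdsWithin_le_nhds]
          with t ht _
        exact ht.le
    exact this.exists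
  have hshift : ∀ (r : ℝ) p, ∑ j, (g j + r * a q j) * a p j = ∑ j, g j * a p j + r * ip p := by
    intro r p
    simp only [ip, add_mul, Finset.sum_add_distrib, Finset.mul_sum, mul_assoc]
  have hp := hc fun j => g j + t * a q j
  have hm := hc fun j => g j + (-t) * a q j
  have h0 := hc g
  simp only [hshift] at hp hm
  have key : ∑ p, c p * (relu (∑ j, g j * a p j + t * ip p) +
      relu (∑ j, g j * a p j - t * ip p) - 2 * relu (∑ j, g j * a p j)) = 0 := by
    have : ∑ p, c p * (relu (∑ j, g j * a p j + t * ip p) +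
        relu (∑ j, g j * a p j - t * ip p) - 2 * relu (∑ j, g j * a p j)) =
        ∑ p, c p * relu (∑ j, g j * a p j + t * ip p) +
        ∑ p, c p * relu (∑ j, g j * a p j + -t * ip p) -
          2 * ∑ p, c p * relu (∑ j, g j * a p j) := by
      rw [Finset.mul_sum, ← Finset.sum_add_distrib, ← Finset.sum_sub_distrib]
      refine Finset.sum_congr rfl fun p _ => ?_
      rw [neg_mul, ← sub_eq_add_neg]
      ring
    rw [this, hp, hm, h0]
    ring
  rw [Finset.sum_eq_single q] at key
  · have hipq : ip q = S := by
      simp only [ip, hS, sq]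
    rw [hgq, hipq] at key
    have hpos : 0 < t * S := mul_pos ht0 hsq
    have r1 : relu (0 + t * S) = t * S := by simp [relu, hpos.le]
    have r2 : relu (0 - t * S) = 0 := by simp [relu, hpos.le]
    have r3 : relu 0 = 0 := by simp [relu]
    rw [r1, r2, r3] at key
    have : c q * (t * S) = 0 := by linarith
    exact (mul_eq_zero.mp this).resolve_right hpos.ne'
  · intro p _ hpq
    rw [relu_add_add_relu_sub (ht p hpq)]
    ring
  · simp

instance isOpenPosMeasure_gaussVec_one {v : NNReal} [hv : Fact (v ≠ 0)] :
    (gaussVec ι v).IsOpenPosMeasure := by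
  have : (gaussianReal 0 v).IsOpenPosMeasure :=
    (gaussianReal_absolutelyContinuous' 0 hv.out).isOpenPosMeasure
  infer_instance

lemma memLp_gaussVec_eval (v : NNReal) (j : ι) : MemLp (fun w : ι → ℝ => w j) 2 (gaussVec ι v) :=
  (memLp_id_gaussianReal' 2 (by simp)).comp_measurePreserving
    (measurePreserving_eval (fun _ : ι => gaussianReal 0 v) j)

lemma memLp_relu_dot (v : NNReal) (a : ι → ℝ) :
    MemLp (fun w : ι → ℝ => relu (∑ j, w j * a j)) 2 (gaussVec ι v) := by
  have h : MemLp (fun w : ι → ℝ => ∑ j, w j * a j) 2 (gaussVec ι v) :=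
    memLp_finsetSum _ fun j _ => (memLp_gaussVec_eval v j).mul_const (a j)
  refine h.mono (continuous_relu.comp (by fun_prop)).aestronglyMeasurable ?_
  exact Filter.Eventually.of_forall fun w => abs_relu_le _

lemma integrable_relu_mul_relu (v : NNReal) (a b : ι → ℝ) :
    Integrable (fun w : ι → ℝ => relu (∑ j, w j * a j) * relu (∑ j, w j * b j)) (gaussVec ι v) :=
  (memLp_relu_dot v a).integrable_mul (memLp_relu_dot v b)

/-- The kernel `E relu ⟨w, a⟩ relu ⟨w, b⟩` for an isotropic Gaussian vector `w`. -/
def reluKernel (v : NNReal) (a b : ι → ℝ) : ℝ :=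
  ∫ w, relu (∑ j, w j * a j) * relu (∑ j, w j * b j) ∂(gaussVec ι v)

lemma memLp_sum_relu (v : NNReal) (a : ν → ι → ℝ) (c : ν → ℝ) :
    MemLp (fun w : ι → ℝ => ∑ p, c p * relu (∑ j, w j * a p j)) 2 (gaussVec ι v) :=
  memLp_finsetSum _ fun p _ => (memLp_relu_dot v (a p)).const_mul (c p)

lemma sum_reluKernel (v : NNReal) (a : ν → ι → ℝ) (c : ν → ℝ) :
    ∑ p, ∑ q, c p * c q * reluKernel v (a p) (a q) =
      ∫ w, (∑ p, c p * relu (∑ j, w j * a p j)) ^ 2 ∂(gaussVec ι v) := by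
  simp only [reluKernel, ← integral_const_mul]
  have hi : ∀ p q, Integrable (fun w : ι → ℝ =>
      c p * c q * (relu (∑ j, w j * a p j) * relu (∑ j, w j * a q j))) (gaussVec ι v) :=
    fun p q => (integrable_relu_mul_relu v (a p) (a q)).const_mul _
  rw [← Finset.sum_congr rfl fun p _ => integral_finsetSum _ fun q _ => hi p q,
    ← integral_finsetSum _ fun p _ => integrable_finsetSum _ fun q _ => hi p q]
  refine integral_congr_ae (Filter.Eventually.of_forall fun w => ?_)
  simp only [sq, Finset.sum_mul_sum]
  exact Finset.sum_congr rfl fun _ _ => Finset.sum_congr rfl fun _ _ => by ring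

/-- Uniform nondegeneracy of the ReLU kernel over a compact family of configurations. -/
lemma exists_reluKernel_lower_bound {v : NNReal} (hv : v ≠ 0) (s : ℕ) {𝒦 : Set (ν → ι → ℝ)}
    (h𝒦 : IsCompact 𝒦)
    (hind : ∀ A ∈ 𝒦, ∀ c : ν → ℝ, Sparse s c →
      (∀ g : ι → ℝ, ∑ p, c p * relu (∑ j, g j * A p j) = 0) → c = 0) :
    ∃ κ > 0, ∀ A ∈ 𝒦, ∀ c : ν → ℝ, Sparse s c →
      κ * ∑ p, c p ^ 2 ≤ ∑ p, ∑ q, c p * c q * reluKernel v (A p) (A q) := by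
  have : Fact (v ≠ 0) := ⟨hv⟩
  let φ : (ν → ι → ℝ) × (ν → ℝ) → (ι → ℝ) → ℝ := fun Ac g =>
    ∑ p, Ac.2 p * relu (∑ j, g j * Ac.1 p j)
  have hφ : Continuous (Function.uncurry φ) := by
    have := continuous_relu
    unfold Function.uncurry
    fun_prop
  let Ψ : (ν → ι → ℝ) × (ν → ℝ) → ℝ := fun Ac => ∫ g, min (φ Ac g ^ 2) 1 ∂(gaussVec ι v)
  have hφ1 : ∀ Ac, Continuous (φ Ac) := fun Ac => hφ.comp (Continuous.prodMk_right Ac)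
  have hφ2 : ∀ g, Continuous fun Ac => φ Ac g := fun g => hφ.comp (Continuous.prodMk_left g)
  have hb : ∀ Ac g, ‖min (φ Ac g ^ 2) 1‖ ≤ 1 := fun Ac g => by
    rw [Real.norm_of_nonneg (by positivity)]
    exact min_le_right _ _
  have hΨ : Continuous Ψ := by
    refine continuous_of_dominated (bound := fun _ => 1) ?_ ?_ (integrable_const 1) ?_
    · exact fun Ac => (((hφ1 Ac).pow 2).min continuous_const).aestronglyMeasurable
    · exact fun Ac => Filter.Eventually.of_forall (hb Ac)
    · exact Filter.Eventually.of_forall fun g => ((hφ2 g).pow 2).min continuous_const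
  have h_int : ∀ Ac, Integrable (fun g => min (φ Ac g ^ 2) 1) (gaussVec ι v) := fun Ac =>
    (integrable_const (1 : ℝ)).mono'
      (((hφ1 Ac).pow 2).min continuous_const).aestronglyMeasurable
      (Filter.Eventually.of_forall (hb Ac))
  let Sph : Set (ν → ℝ) := {c | Sparse s c} ∩ {c | ∑ p, c p ^ 2 = 1}
  have hSph : IsCompact Sph := by
    refine (isCompact_closedBall (0 : ν → ℝ) 1).of_isClosed_subset
      ((isClosed_sparse s).inter (isClosed_eq (by fun_prop) continuous_const)) ?_
    rintro c ⟨-, hc⟩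
    rw [mem_closedBall_zero_iff, pi_norm_le_iff_of_nonneg zero_le_one]
    intro p
    have h1 : c p ^ 2 ≤ ∑ p, c p ^ 2 :=
      Finset.single_le_sum (f := fun p => c p ^ 2) (fun _ _ => sq_nonneg _) (Finset.mem_univ p)
    rw [show ∑ p, c p ^ 2 = 1 from hc] at h1
    exact (sq_le_one_iff_abs_le_one _).mp h1
  have hpos : ∀ Ac ∈ 𝒦 ×ˢ Sph, 0 < Ψ Ac := by
    rintro ⟨A, c⟩ ⟨hA, hcs, hc⟩
    have hnn : 0 ≤ Ψ (A, c) := integral_nonneg fun g => by positivity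
    refine lt_of_le_of_ne hnn fun h0 => ?_
    have hz := (integral_eq_zero_iff_of_nonneg (fun g => by positivity) (h_int (A, c))).mp h0.symm
    have hz := (Continuous.ae_eq_iff_eq (μ := gaussVec ι v)
      (((hφ1 (A, c)).pow 2).min continuous_const) continuous_zero).mp hz
    have hc0 := hind A hA c hcs fun g => by
      have := congrFun hz g
      simp only [Pi.zero_apply, Pi.pow_apply] at this
      rcases min_choice (φ (A, c) g ^ 2) 1 with h | h
      · rw [h] at this
        exact pow_eq_zero_iff two_ne_zero |>.mp this
      · rw [h] at this
        exact absurd this one_ne_zero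
    subst hc0
    simp at hc
  obtain ⟨κ, hκ, hκle⟩ : ∃ κ > 0, ∀ Ac ∈ 𝒦 ×ˢ Sph, κ ≤ Ψ Ac := by
    rcases (𝒦 ×ˢ Sph).eq_empty_or_nonempty with he | hne
    · exact ⟨1, one_pos, by simp [he]⟩
    · obtain ⟨x, hx, hmin⟩ := (h𝒦.prod hSph).exists_isMinOn hne hΨ.continuousOn
      exact ⟨Ψ x, hpos x hx, fun y hy => hmin hy⟩
  refine ⟨κ, hκ, fun A hA c hc => ?_⟩
  rw [sum_reluKernel]
  have hS0 : 0 ≤ ∑ p, c p ^ 2 := Finset.sum_nonneg fun _ _ => sq_nonneg _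
  rcases hS0.eq_or_lt with h0 | hS
  · rw [← h0, mul_zero]
    exact integral_nonneg fun w => sq_nonneg _
  set S := ∑ p, c p ^ 2 with hSdef
  have hsq : Real.sqrt S ^ 2 = S := Real.sq_sqrt hS0
  have hsq0 : Real.sqrt S ≠ 0 := (Real.sqrt_pos.mpr hS).ne'
  have hmem : (A, (Real.sqrt S)⁻¹ • c) ∈ 𝒦 ×ˢ Sph := by
    refine ⟨hA, hc.smul _, ?_⟩
    simp only [Set.mem_ofPred_eq, Pi.smul_apply, smul_eq_mul, mul_pow, ← Finset.mul_sum, inv_pow,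
      hsq, ← hSdef]
    exact inv_mul_cancel₀ hS.ne'
  have h1 := hκle _ hmem
  have h2 : Ψ (A, (Real.sqrt S)⁻¹ • c) ≤
      ∫ w, S⁻¹ * (∑ p, c p * relu (∑ j, w j * A p j)) ^ 2 ∂(gaussVec ι v) := by
    refine integral_mono (h_int _) ((memLp_sum_relu v A c).integrable_sq.const_mul _) fun w => ?_
    refine (min_le_left _ _).trans (le_of_eq ?_)
    simp only [φ, Pi.smul_apply, smul_eq_mul, mul_assoc, ← Finset.mul_sum, mul_pow, inv_pow, hsq]
  rw [integral_const_mul] at h2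
  have h3 := h1.trans h2
  rw [inv_mul_eq_div, le_div_iff₀ hS] at h3
  exact h3

lemma reluKernel_congr {κ : Type*} [Fintype κ] (v v' : NNReal) (a : ν → ι → ℝ)
    (b : ν → κ → ℝ) (h : ∀ p q, v * ∑ j, a p j * a q j = v' * ∑ j, b p j * b q j) (p q : ν) :
    reluKernel v (a p) (a q) = reluKernel v' (b p) (b q) := by
  have hl := gaussVec_map_linear_congr v v' a b h
  have hf : Continuous fun z : ν → ℝ => relu (z p) * relu (z q) := by
    have := continuous_relu
    fun_prop
  have ha : Measurable fun (w : ι → ℝ) p => ∑ j, w j * a p j := by fun_prop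
  have hb : Measurable fun (w : κ → ℝ) p => ∑ j, w j * b p j := by fun_prop
  have e : reluKernel v (a p) (a q) =
      ∫ y, relu (y p) * relu (y q) ∂((gaussVec ι v).map (fun w p => ∑ j, w j * a p j)) := by
    rw [integral_map ha.aemeasurable hf.aestronglyMeasurable]
    rfl
  have e' : reluKernel v' (b p) (b q) =
      ∫ y, relu (y p) * relu (y q) ∂((gaussVec κ v').map (fun w p => ∑ j, w j * b p j)) := by
    rw [integral_map hb.aemeasurable hf.aestronglyMeasurable]
    rfl
  rw [e, e', hl]

open scoped Matrix MatrixOrder in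
lemma exists_gram_factor [DecidableEq ν] (v : NNReal) (a : ν → ι → ℝ) :
    ∃ b : ν → ν → ℝ, ∀ p q, v * ∑ j, a p j * a q j = ∑ j, b p j * b q j := by
  let X : Matrix ν ι ℝ := fun p j => Real.sqrt v * a p j
  have hps : (X * Xᴴ).PosSemidef := Matrix.posSemidef_self_mul_conjTranspose X
  obtain ⟨B, hB⟩ := CStarAlgebra.nonneg_iff_eq_star_mul_self.mp hps.nonneg
  refine ⟨fun p j => B j p, fun p q => ?_⟩
  have h1 := congrFun (congrFun hB p) q
  simp only [Matrix.star_eq_conjTranspose, Matrix.mul_apply, Matrix.conjTranspose_apply,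
    star_trivial, X] at h1
  rw [← h1, Finset.mul_sum]
  change _ = ∑ j, Real.sqrt v * a p j * (Real.sqrt v * a q j)
  have hs : Real.sqrt v * Real.sqrt v = v := Real.mul_self_sqrt v.2
  exact Finset.sum_congr rfl fun j _ => by linear_combination (-(a p j * a q j)) * hs

lemma sum_sq_lin_comb (a : ν → ι → ℝ) (c : ν → ℝ) :
    ∑ j, (∑ p, c p * a p j) ^ 2 = ∑ p, ∑ q, c p * c q * ∑ j, a p j * a q j := by
  rw [← sum_sq_sum_mul]
  simp only [mul_comm]

/-- Pairwise quantitative non-collinearity of the inputs propagates, dimension-free, to full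
quantitative nondegeneracy of the ReLU kernel. -/
lemma exists_reluKernel_lower_bound_of_pairwise {κ : ℝ} (hκ : 0 < κ) (R : ℝ) (ν : Type*)
    [Fintype ν] :
    ∃ κ' > 0, ∀ (m : ℕ) (v : NNReal) (a : ν → Fin m → ℝ),
      (∀ p, v * ∑ j, a p j ^ 2 ≤ R) →
      (∀ c : ν → ℝ, Sparse 2 c → κ * ∑ p, c p ^ 2 ≤ v * ∑ j, (∑ p, c p * a p j) ^ 2) →
      ∀ c : ν → ℝ, κ' * ∑ p, c p ^ 2 ≤ ∑ p, ∑ q, c p * c q * reluKernel v (a p) (a q) := by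
  classical
  let 𝒦 : Set (ν → ν → ℝ) := {A | (∀ p, ∑ j, A p j ^ 2 ≤ R) ∧
    ∀ c : ν → ℝ, Sparse 2 c → κ * ∑ p, c p ^ 2 ≤ ∑ j, (∑ p, c p * A p j) ^ 2}
  have hclosed : IsClosed 𝒦 := by
    simp only [𝒦, Set.ofPred_and, Set.ofPred_forall]
    refine IsClosed.inter (isClosed_iInter fun p => isClosed_le (by fun_prop) continuous_const)
      (isClosed_iInter fun c => isClosed_iInter fun _ => isClosed_le continuous_const (by fun_prop))
  have hcomp : IsCompact 𝒦 := by
    refine (isCompact_closedBall (0 : ν → ν → ℝ) (Real.sqrt R)).of_isClosed_subset hclosed ?_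
    rintro A ⟨hA, -⟩
    rw [mem_closedBall_zero_iff, pi_norm_le_iff_of_nonneg (Real.sqrt_nonneg _)]
    intro p
    rw [pi_norm_le_iff_of_nonneg (Real.sqrt_nonneg _)]
    intro j
    refine Real.abs_le_sqrt ((Finset.single_le_sum (f := fun j => A p j ^ 2)
      (fun _ _ => sq_nonneg _) (Finset.mem_univ j)).trans (hA p))
  obtain ⟨κ', hκ', h⟩ := exists_reluKernel_lower_bound (v := 1) one_ne_zero (Fintype.card ν) hcomp
    fun A hA c _ hc => relu_linearIndependent A (fun c hs hz => by
      have h1 := hA.2 c hs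
      simp only [hz] at h1
      have h2 : ∑ p, c p ^ 2 ≤ 0 := by
        by_contra hcon
        push Not at hcon
        have := mul_pos hκ hcon
        simp at h1
        linarith
      have h3 := (Finset.sum_eq_zero_iff_of_nonneg fun p _ => sq_nonneg (c p)).mp
        (le_antisymm h2 (Finset.sum_nonneg fun _ _ => sq_nonneg _))
      funext p
      exact pow_eq_zero_iff two_ne_zero |>.mp (h3 p (Finset.mem_univ p))) c hc
  refine ⟨κ', hκ', fun m v a hR ha c => ?_⟩
  obtain ⟨b, hb⟩ := exists_gram_factor v a
  have hbmem : b ∈ 𝒦 := by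
    refine ⟨fun p => ?_, fun c hc => ?_⟩
    · have := hR p
      simp only [sq] at this ⊢
      rwa [← hb p p]
    · refine (ha c hc).trans (le_of_eq ?_)
      rw [sum_sq_lin_comb, sum_sq_lin_comb, Finset.mul_sum]
      refine Finset.sum_congr rfl fun p _ => ?_
      rw [Finset.mul_sum]
      refine Finset.sum_congr rfl fun q _ => ?_
      rw [← hb p q]
      ring
  refine (h b hbmem c (sparse_card c)).trans (le_of_eq ?_)
  refine Finset.sum_congr rfl fun p _ => Finset.sum_congr rfl fun q _ => ?_
  rw [reluKernel_congr v 1 a b (fun p q => by rw [hb p q]; simp)]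

end Relu

section Resample

variable {δ : Type*} [Fintype δ] {X : δ → Type*} [∀ i, MeasurableSpace (X i)]
  (μ : ∀ i, Measure (X i)) [∀ i, IsProbabilityMeasure (μ i)]

lemma lintegral_pi_eval (i : δ) {f : X i → ENNReal} (hf : Measurable f) :
    ∫⁻ x, f (x i) ∂(Measure.pi μ) = ∫⁻ y, f y ∂(μ i) :=
  (measurePreserving_eval μ i).lintegral_comp hf

variable [DecidableEq δ]

lemma lintegral_pi_resample (i : δ) {f : (∀ i, X i) → ENNReal} (hf : Measurable f) :
    ∫⁻ x, f x ∂(Measure.pi μ) = ∫⁻ x, ∫⁻ y, f (Function.update x i y) ∂(μ i) ∂(Measure.pi μ) := by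
  have h := lmarginal_singleton (μ := μ) f i
  have hg : Measurable fun x => ∫⁻ y, f (Function.update x i y) ∂(μ i) := by
    rw [← h]
    exact hf.lmarginal μ
  refine lintegral_eq_of_lmarginal_eq {i} hf hg ?_
  rw [lmarginal_singleton, lmarginal_singleton]
  simp

lemma lintegral_pi_le_of_resample (i : δ) {f g : (∀ i, X i) → ENNReal} (hf : Measurable f)
    (h : ∀ x, ∫⁻ y, f (Function.update x i y) ∂(μ i) ≤ g x) :
    ∫⁻ x, f x ∂(Measure.pi μ) ≤ ∫⁻ x, g x ∂(Measure.pi μ) := by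
  rw [lintegral_pi_resample μ i hf]
  exact lintegral_mono h

lemma lintegral_pi_eval_two {i j : δ} (hij : i ≠ j) {f : X i → X j → ENNReal}
    (hf : Measurable (Function.uncurry f)) :
    ∫⁻ x, f (x i) (x j) ∂(Measure.pi μ) = ∫⁻ z, ∫⁻ y, f y z ∂(μ i) ∂(μ j) := by
  have hm : Measurable fun x : ∀ i, X i => f (x i) (x j) :=
    hf.comp ((measurable_pi_apply i).prodMk (measurable_pi_apply j))
  rw [lintegral_pi_resample μ i hm]
  simp only [Function.update_self, Function.update_of_ne hij.symm]
  exact lintegral_pi_eval μ j (f := fun z => ∫⁻ y, f y z ∂(μ i)) hf.lintegral_prod_left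

end Resample

lemma markov_ofReal {Ω : Type*} [MeasurableSpace Ω] (μ : Measure Ω) {f : Ω → ℝ}
    (hf : Measurable f) {t c : ℝ} (ht : 0 < t)
    (h : ∫⁻ x, ENNReal.ofReal (f x) ∂μ ≤ ENNReal.ofReal c) :
    μ {x | t ≤ f x} ≤ ENNReal.ofReal (c / t) := by
  have h1 := meas_ge_le_lintegral_div (μ := μ) (f := fun x => ENNReal.ofReal (f x))
    hf.ennreal_ofReal.aemeasurable (ε := ENNReal.ofReal t)
    (by simpa using ht) ENNReal.ofReal_ne_top
  rw [ENNReal.ofReal_div_of_pos ht]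
  refine (measure_mono fun x hx => ?_).trans (h1.trans (ENNReal.div_le_div_right h _))
  exact ENNReal.ofReal_le_ofReal hx

/-- A random `m × n` weight matrix with fan-in initialization. -/
abbrev gaussMat (m n : ℕ) : Measure (Fin m → Fin n → ℝ) :=
  Measure.pi fun _ => gaussVec (Fin n) ((n : NNReal))⁻¹

section GaussMat

variable {m n : ℕ}

lemma coe_inv_natCast (n : ℕ) : (((n : NNReal)⁻¹ : NNReal) : ℝ) = (n : ℝ)⁻¹ := by simp

lemma lintegral_gaussMat_dot_sq (i : Fin m) (h : Fin n → ℝ) :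
    ∫⁻ W, ENNReal.ofReal ((∑ j, W i j * h j) ^ 2) ∂(gaussMat m n) =
      ENNReal.ofReal ((n : ℝ)⁻¹ * ∑ j, h j ^ 2) := by
  rw [lintegral_pi_eval (fun _ : Fin m => gaussVec (Fin n) ((n : NNReal))⁻¹) i
    (f := fun w => ENNReal.ofReal ((∑ j, w j * h j) ^ 2)) (by fun_prop),
    lintegral_gaussVec_dot_sq, coe_inv_natCast]

lemma lintegral_gaussMat_relu_sq_le (h : Fin n → ℝ) :
    ∫⁻ W, ENNReal.ofReal ((m : ℝ)⁻¹ * ∑ i, relu (∑ j, W i j * h j) ^ 2) ∂(gaussMat m n) ≤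
      ENNReal.ofReal ((n : ℝ)⁻¹ * ∑ j, h j ^ 2) := by
  have h0 : 0 ≤ (n : ℝ)⁻¹ * ∑ j, h j ^ 2 :=
    mul_nonneg (by positivity) (Finset.sum_nonneg fun _ _ => sq_nonneg _)
  calc ∫⁻ W, ENNReal.ofReal ((m : ℝ)⁻¹ * ∑ i, relu (∑ j, W i j * h j) ^ 2) ∂(gaussMat m n)
      ≤ ∫⁻ W, ENNReal.ofReal (m : ℝ)⁻¹ * ∑ i, ENNReal.ofReal ((∑ j, W i j * h j) ^ 2)
          ∂(gaussMat m n) := by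
        refine lintegral_mono fun W => ?_
        rw [← ENNReal.ofReal_sum_of_nonneg fun _ _ => sq_nonneg _,
          ← ENNReal.ofReal_mul (by positivity)]
        exact ENNReal.ofReal_le_ofReal (mul_le_mul_of_nonneg_left
          (Finset.sum_le_sum fun i _ => relu_sq_le _) (by positivity))
    _ = ENNReal.ofReal (m : ℝ)⁻¹ * (m * ENNReal.ofReal ((n : ℝ)⁻¹ * ∑ j, h j ^ 2)) := by
        rw [lintegral_const_mul _ (by fun_prop), lintegral_finsetSum _ fun i _ => by fun_prop]
        simp only [lintegral_gaussMat_dot_sq, Finset.sum_const, Finset.card_univ,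
          Fintype.card_fin, nsmul_eq_mul]
    _ ≤ _ := by
        rw [← ENNReal.ofReal_natCast, ← ENNReal.ofReal_mul (by positivity),
          ← ENNReal.ofReal_mul (by positivity)]
        refine ENNReal.ofReal_le_ofReal ?_
        rw [← mul_assoc]
        exact mul_le_of_le_one_left h0 (inv_mul_le_one)

lemma lintegral_gaussMat_bilin_sq {i i' : Fin m} (hi : i ≠ i') (G : Fin n → Fin n → ℝ) :
    ∫⁻ W, ENNReal.ofReal ((∑ j, ∑ k, W i j * W i' k * G j k) ^ 2) ∂(gaussMat m n) =
      ENNReal.ofReal ((n : ℝ)⁻¹ ^ 2 * ∑ j, ∑ k, G j k ^ 2) := by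
  rw [lintegral_pi_eval_two (fun _ : Fin m => gaussVec (Fin n) ((n : NNReal))⁻¹) hi
    (f := fun x y => ENNReal.ofReal ((∑ j, ∑ k, x j * y k * G j k) ^ 2))
    (by unfold Function.uncurry; fun_prop), lintegral_gaussVec_bilin_sq, coe_inv_natCast]

lemma lintegral_gaussMat_quad_sq_le (i : Fin m) (G : Fin n → Fin n → ℝ) :
    ∫⁻ W, ENNReal.ofReal ((∑ j, ∑ k, W i j * W i k * G j k) ^ 2) ∂(gaussMat m n) ≤
      ENNReal.ofReal (gaussFourth * ((n : ℝ)⁻¹ * ∑ j, ∑ k, G j k ^ 2)) := by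
  rw [lintegral_pi_eval (fun _ : Fin m => gaussVec (Fin n) ((n : NNReal))⁻¹) i
    (f := fun w => ENNReal.ofReal ((∑ j, ∑ k, w j * w k * G j k) ^ 2)) (by fun_prop)]
  refine (lintegral_gaussVec_quad_sq_le _ G).trans (ENNReal.ofReal_le_ofReal (le_of_eq ?_))
  rw [coe_inv_natCast, Fintype.card_fin]
  rcases eq_or_ne (n : ℝ) 0 with h | h
  · simp [h]
  · field_simp

lemma lintegral_gaussMat_quad_diff_sq_le {i i' : Fin m} (hi : i ≠ i') (G : Fin n → Fin n → ℝ) :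
    ∫⁻ W, ENNReal.ofReal ((∑ j, ∑ k, W i j * W i k * G j k -
        ∑ j, ∑ k, W i' j * W i' k * G j k) ^ 2) ∂(gaussMat m n) ≤
      ENNReal.ofReal (4 * (n : ℝ)⁻¹ ^ 2 * ∑ j, ∑ k, G j k ^ 2) := by
  rw [lintegral_pi_eval_two (fun _ : Fin m => gaussVec (Fin n) ((n : NNReal))⁻¹) hi
    (f := fun x y => ENNReal.ofReal ((∑ j, ∑ k, x j * x k * G j k -
        ∑ j, ∑ k, y j * y k * G j k) ^ 2))
    (by unfold Function.uncurry; fun_prop)]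
  refine le_trans (le_of_eq ?_) ((lintegral_gaussVec_quad_diff_sq_le _ G).trans_eq
    (by rw [coe_inv_natCast]))
  refine lintegral_congr fun z => lintegral_congr fun y => ?_
  congr 1
  ring

lemma lintegral_gaussMat_conj_sq_le (G : Fin n → Fin n → ℝ) :
    ∫⁻ W, ENNReal.ofReal (∑ i, ∑ i', (∑ j, ∑ k, W i j * W i' k * G j k) ^ 2) ∂(gaussMat m n) ≤
      ENNReal.ofReal (((m / n) ^ 2 + gaussFourth * (m / n)) * ∑ j, ∑ k, G j k ^ 2) := by
  have hG : 0 ≤ ∑ j, ∑ k, G j k ^ 2 :=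
    Finset.sum_nonneg fun _ _ => Finset.sum_nonneg fun _ _ => sq_nonneg _
  have h4 := gaussFourth_nonneg
  have h1 : ∀ i i' : Fin m,
      ∫⁻ W, ENNReal.ofReal ((∑ j, ∑ k, W i j * W i' k * G j k) ^ 2) ∂(gaussMat m n) ≤
        ENNReal.ofReal ((n : ℝ)⁻¹ ^ 2 * ∑ j, ∑ k, G j k ^ 2 +
          if i = i' then gaussFourth * ((n : ℝ)⁻¹ * ∑ j, ∑ k, G j k ^ 2) else 0) := by
    intro i i'
    by_cases h : i = i'
    · subst h
      refine (lintegral_gaussMat_quad_sq_le i G).trans (ENNReal.ofReal_le_ofReal ?_)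
      simp only [if_true]
      linarith [mul_nonneg (sq_nonneg (n : ℝ)⁻¹) hG]
    · rw [lintegral_gaussMat_bilin_sq h, if_neg h, add_zero]
  simp_rw [ENNReal.ofReal_sum_of_nonneg (fun i _ => Finset.sum_nonneg fun _ _ => sq_nonneg _),
    ENNReal.ofReal_sum_of_nonneg (fun _ _ => sq_nonneg _)]
  rw [lintegral_finsetSum _ fun i _ => by fun_prop]
  have h3 : ∀ i : Fin m, ∫⁻ W, ∑ i' : Fin m,
      ENNReal.ofReal ((∑ j, ∑ k, W i j * W i' k * G j k) ^ 2) ∂(gaussMat m n) =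
      ∑ i' : Fin m, ∫⁻ W, ENNReal.ofReal ((∑ j, ∑ k, W i j * W i' k * G j k) ^ 2)
        ∂(gaussMat m n) := fun i => lintegral_finsetSum _ fun i' _ => by fun_prop
  simp only [h3]
  refine (Finset.sum_le_sum fun i _ => Finset.sum_le_sum fun i' _ => h1 i i').trans ?_
  have h2 : ∀ i i' : Fin m, 0 ≤ (n : ℝ)⁻¹ ^ 2 * ∑ j, ∑ k, G j k ^ 2 +
          if i = i' then gaussFourth * ((n : ℝ)⁻¹ * ∑ j, ∑ k, G j k ^ 2) else 0 := by
    intro i i'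
    split_ifs <;> positivity
  simp_rw [← ENNReal.ofReal_sum_of_nonneg fun i' _ => h2 _ i']
  rw [← ENNReal.ofReal_sum_of_nonneg fun i _ => Finset.sum_nonneg fun i' _ => h2 i i']
  refine ENNReal.ofReal_le_ofReal (le_of_eq ?_)
  simp only [Finset.sum_add_distrib, Finset.sum_ite_eq, Finset.mem_univ, if_true,
    Finset.sum_const, Finset.card_univ, Fintype.card_fin, nsmul_eq_mul]
  ring

lemma lintegral_gaussMat_gram_sub_sq_le (hm : m ≠ 0) {a b : Fin n → ℝ} {R : ℝ}
    (ha : (n : ℝ)⁻¹ * ∑ j, a j ^ 2 ≤ R) (hb : (n : ℝ)⁻¹ * ∑ j, b j ^ 2 ≤ R) :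
    ∫⁻ W, ENNReal.ofReal (((m : ℝ)⁻¹ * ∑ i, relu (∑ j, W i j * a j) * relu (∑ j, W i j * b j) -
        reluKernel (n : NNReal)⁻¹ a b) ^ 2) ∂(gaussMat m n) ≤
      ENNReal.ofReal (gaussFourth * R ^ 2 / m) := by
  set μ := gaussVec (Fin n) (n : NNReal)⁻¹ with hμ
  have hm' : (m : ℝ) ≠ 0 := by exact_mod_cast hm
  let r : (Fin n → ℝ) → ℝ := fun w => relu (∑ j, w j * a j) * relu (∑ j, w j * b j)
  have hrc : Continuous r := by
    have := continuous_relu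
    fun_prop
  have hr2 : ∫⁻ w, ENNReal.ofReal (r w ^ 2) ∂μ ≤ ENNReal.ofReal (gaussFourth * R ^ 2) := by
    refine le_trans (lintegral_mono fun w => ENNReal.ofReal_le_ofReal ?_)
      ((lintegral_gaussVec_dot_sq_mul_dot_sq_le _ a b).trans (ENNReal.ofReal_le_ofReal ?_))
    · simp only [r, mul_pow]
      exact mul_le_mul (relu_sq_le _) (relu_sq_le _) (sq_nonneg _) (sq_nonneg _)
    · rw [coe_inv_natCast, mul_assoc]
      refine mul_le_mul_of_nonneg_left ?_ gaussFourth_nonneg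
      have e : ((n : ℝ)⁻¹ ^ 2 * ((∑ j, a j ^ 2) * ∑ j, b j ^ 2)) =
        ((n : ℝ)⁻¹ * ∑ j, a j ^ 2) * ((n : ℝ)⁻¹ * ∑ j, b j ^ 2) := by ring
      have ha0 : 0 ≤ (n : ℝ)⁻¹ * ∑ j, a j ^ 2 :=
        mul_nonneg (by positivity) (Finset.sum_nonneg fun _ _ => sq_nonneg _)
      have hb0 : 0 ≤ (n : ℝ)⁻¹ * ∑ j, b j ^ 2 :=
        mul_nonneg (by positivity) (Finset.sum_nonneg fun _ _ => sq_nonneg _)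
      rw [e, sq R]
      exact mul_le_mul ha hb hb0 (ha0.trans ha)
  have h_int : Integrable (fun w => r w ^ 2) μ := by
    refine ⟨(hrc.pow 2).aestronglyMeasurable, ?_⟩
    rw [hasFiniteIntegral_iff_ofReal (Filter.Eventually.of_forall fun w => sq_nonneg _)]
    exact hr2.trans_lt ENNReal.ofReal_lt_top
  have hr : MemLp r 2 μ := (memLp_two_iff_integrable_sq hrc.aestronglyMeasurable).mpr h_int
  have hX : ∀ _ : Fin m, MemLp (fun w => (m : ℝ)⁻¹ * r w) 2 μ := fun _ => hr.const_mul _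
  have hXi : ∀ i : Fin m, MemLp (fun W : Fin m → Fin n → ℝ => (m : ℝ)⁻¹ * r (W i)) 2
      (gaussMat m n) := fun i =>
    (hX i).comp_measurePreserving (measurePreserving_eval (fun _ : Fin m => μ) i)
  let F : (Fin m → Fin n → ℝ) → ℝ := ∑ i, fun W => (m : ℝ)⁻¹ * r (W i)
  have hF : MemLp F 2 (gaussMat m n) := memLp_finsetSum' _ fun i _ => hXi i
  have hFe : ∀ W, F W =
      (m : ℝ)⁻¹ * ∑ i, relu (∑ j, W i j * a j) * relu (∑ j, W i j * b j) := fun W => by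
    simp [F, r, Finset.mul_sum]
  have hmean : ∫ W, F W ∂(gaussMat m n) = reluKernel (n : NNReal)⁻¹ a b := by
    simp only [F, Finset.sum_apply]
    rw [integral_finsetSum _ fun i _ => (hXi i).integrable one_le_two]
    have : ∀ i : Fin m, ∫ W, (m : ℝ)⁻¹ * r (W i) ∂(gaussMat m n) =
        (m : ℝ)⁻¹ * reluKernel (n : NNReal)⁻¹ a b := fun i => by
      rw [integral_const_mul]
      congr 1
      have h := integral_map (μ := gaussMat m n) (φ := fun W => W i)
        (measurable_pi_apply i).aemeasurable (f := r) hrc.aestronglyMeasurable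
      rw [(measurePreserving_eval (fun _ : Fin m => μ) i).map_eq] at h
      exact h.symm
    simp only [this, Finset.sum_const, Finset.card_univ, Fintype.card_fin, nsmul_eq_mul]
    field_simp
  have hvar : Var[F; gaussMat m n] ≤ gaussFourth * R ^ 2 / m := by
    rw [variance_sum_pi (X := fun _ w => (m : ℝ)⁻¹ * r w) hX]
    have h1 : Var[fun w => (m : ℝ)⁻¹ * r w; μ] ≤ (m : ℝ)⁻¹ ^ 2 * (gaussFourth * R ^ 2) := by
      rw [variance_const_mul]
      refine mul_le_mul_of_nonneg_left ?_ (sq_nonneg _)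
      refine (variance_le_expectation_sq hrc.aestronglyMeasurable).trans ?_
      have h2 := ofReal_integral_eq_lintegral_ofReal h_int
        (Filter.Eventually.of_forall fun w => sq_nonneg _)
      rw [← h2] at hr2
      exact (ENNReal.ofReal_le_ofReal_iff (by have := gaussFourth_nonneg; positivity)).mp hr2
    refine (Finset.sum_le_sum fun i _ => h1).trans (le_of_eq ?_)
    simp only [Finset.sum_const, Finset.card_univ, Fintype.card_fin, nsmul_eq_mul]
    field_simp
  have h := ofReal_variance hF
  rw [evariance_eq_lintegral_ofReal, hmean] at h
  simp only [hFe] at h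
  rw [← h]
  exact ENNReal.ofReal_le_ofReal hvar

end GaussMat

section Network

variable {L : ℕ} {w : ℕ → ℕ}

instance isProbabilityMeasure_initMeasure : IsProbabilityMeasure (initMeasure L w) := by
  unfold initMeasure
  infer_instance

lemma lintegral_initMeasure_le_of_resample (l : Fin L) {f g : Params L w → ENNReal}
    (hf : Measurable f)
    (h : ∀ θ, ∫⁻ W, f (Function.update θ l W) ∂(gaussMat (w (l + 1)) (w l)) ≤ g θ) :
    ∫⁻ θ, f θ ∂(initMeasure L w) ≤ ∫⁻ θ, g θ ∂(initMeasure L w) :=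
  lintegral_pi_le_of_resample (fun l : Fin L => gaussMat (w (l + 1)) (w l)) l hf h

lemma extParams_update_self (θ : Params L w) (l : Fin L)
    (W : Fin (w (l + 1)) → Fin (w l) → ℝ) : extParams (Function.update θ l W) l = W := by
  simp [extParams]

lemma extParams_update_of_ne (θ : Params L w) (l : Fin L)
    (W : Fin (w (l + 1)) → Fin (w l) → ℝ) {k : ℕ} (hk : k ≠ l) :
    extParams (Function.update θ l W) k = extParams θ k := by
  unfold extParams
  split_ifs with h
  · exact Function.update_of_ne (fun e => hk (congrArg Fin.val e)) _ _
  · rfl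

lemma layerOut_congr {θ θ' : (l : ℕ) → Fin (w (l + 1)) → Fin (w l) → ℝ} (x : Fin (w 0) → ℝ) :
    ∀ {l : ℕ}, (∀ k < l, θ k = θ' k) → layerOut w θ l x = layerOut w θ' l x
  | 0, _ => rfl
  | l + 1, h => by
    funext i
    simp only [layerOut, layerOut_congr x fun k hk => h k (hk.trans l.lt_succ_self),
      h l l.lt_succ_self]

lemma layerOut_update (θ : Params L w) (l : Fin L) (W : Fin (w (l + 1)) → Fin (w l) → ℝ)
    (x : Fin (w 0) → ℝ) {k : ℕ} (hk : k ≤ l) :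
    layerOut w (extParams (Function.update θ l W)) k x = layerOut w (extParams θ) k x :=
  layerOut_congr x fun _ hj => extParams_update_of_ne θ l W (hj.trans_le hk).ne

lemma layerOut_update_succ (θ : Params L w) (l : Fin L) (W : Fin (w (l + 1)) → Fin (w l) → ℝ)
    (x : Fin (w 0) → ℝ) (i : Fin (w (l + 1))) :
    layerOut w (extParams (Function.update θ l W)) (l + 1) x i =
      relu (∑ j, W i j * layerOut w (extParams θ) l x j) := by
  simp only [layerOut, layerOut_update θ l W x le_rfl, extParams_update_self]

lemma continuous_extParams (l : ℕ) (i : Fin (w (l + 1))) (j : Fin (w l)) :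
    Continuous fun θ : Params L w => extParams θ l i j := by
  unfold extParams
  split_ifs with h
  · fun_prop
  · exact continuous_const

lemma continuous_layerOut (x : Fin (w 0) → ℝ) : ∀ (l : ℕ) (i : Fin (w l)),
    Continuous fun θ : Params L w => layerOut w (extParams θ) l x i
  | 0, _ => continuous_const
  | l + 1, i => by
    simp only [layerOut]
    exact continuous_relu.comp (continuous_finsetSum _ fun j _ =>
      (continuous_extParams l i j).mul (continuous_layerOut x l j))

/-- Pre-activations of layer `l + 1`. -/
def preAct (w : ℕ → ℕ) (θ : (l : ℕ) → Fin (w (l + 1)) → Fin (w l) → ℝ) (l : ℕ)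
    (x : Fin (w 0) → ℝ) (i : Fin (w (l + 1))) : ℝ :=
  ∑ j, θ l i j * layerOut w θ l x j

lemma continuous_preAct (x : Fin (w 0) → ℝ) (l : ℕ) (i : Fin (w (l + 1))) :
    Continuous fun θ : Params L w => preAct w (extParams θ) l x i :=
  continuous_finsetSum _ fun j _ => (continuous_extParams l i j).mul (continuous_layerOut x l j)

lemma preAct_update (θ : Params L w) (l : Fin L) (W : Fin (w (l + 1)) → Fin (w l) → ℝ)
    (x : Fin (w 0) → ℝ) (i : Fin (w (l + 1))) :
    preAct w (extParams (Function.update θ l W)) l x i =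
      ∑ j, W i j * layerOut w (extParams θ) l x j := by
  simp only [preAct, layerOut_update θ l W x le_rfl, extParams_update_self]

/-- Mean square of the activations of layer `l`. -/
def meanSq (w : ℕ → ℕ) (θ : (l : ℕ) → Fin (w (l + 1)) → Fin (w l) → ℝ) (l : ℕ)
    (x : Fin (w 0) → ℝ) : ℝ :=
  (w l : ℝ)⁻¹ * ∑ j, layerOut w θ l x j ^ 2

lemma meanSq_nonneg (θ : (l : ℕ) → Fin (w (l + 1)) → Fin (w l) → ℝ) (l : ℕ)
    (x : Fin (w 0) → ℝ) : 0 ≤ meanSq w θ l x :=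
  mul_nonneg (by positivity) (Finset.sum_nonneg fun _ _ => sq_nonneg _)

lemma continuous_meanSq (x : Fin (w 0) → ℝ) (l : ℕ) :
    Continuous fun θ : Params L w => meanSq w (extParams θ) l x :=
  continuous_const.mul (continuous_finsetSum _ fun j _ => (continuous_layerOut x l j).pow 2)

lemma lintegral_meanSq_le (x : Fin (w 0) → ℝ) : ∀ l ≤ L,
    ∫⁻ θ, ENNReal.ofReal (meanSq w (extParams θ) l x) ∂(initMeasure L w) ≤
      ENNReal.ofReal ((w 0 : ℝ)⁻¹ * ∑ j, x j ^ 2)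
  | 0, _ => by simp [meanSq, layerOut]
  | l + 1, hl => by
    refine le_trans ?_ (lintegral_meanSq_le x l (Nat.le_of_succ_le hl))
    refine lintegral_initMeasure_le_of_resample ⟨l, hl⟩
      (continuous_meanSq x _).measurable.ennreal_ofReal fun θ => ?_
    simp only [meanSq, layerOut_update_succ θ ⟨l, hl⟩]
    exact lintegral_gaussMat_relu_sq_le _

lemma lintegral_preAct_sq_le (x : Fin (w 0) → ℝ) {l : ℕ} (hl : l < L) (i : Fin (w (l + 1))) :
    ∫⁻ θ, ENNReal.ofReal (preAct w (extParams θ) l x i ^ 2) ∂(initMeasure L w) ≤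
      ENNReal.ofReal ((w 0 : ℝ)⁻¹ * ∑ j, x j ^ 2) := by
  refine le_trans ?_ (lintegral_meanSq_le (w := w) x l hl.le)
  refine lintegral_initMeasure_le_of_resample ⟨l, hl⟩
    ((continuous_preAct x l i).pow 2).measurable.ennreal_ofReal fun θ => ?_
  simp only [preAct_update θ ⟨l, hl⟩]
  exact (lintegral_gaussMat_dot_sq _ _).le

/-- Almost surely, a pre-activation vanishes only if all activations of the layer below do. -/
lemma ae_preAct_ne_zero (x : Fin (w 0) → ℝ) {l : ℕ} (hl : l < L) (i : Fin (w (l + 1))) :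
    ∀ᵐ θ ∂(initMeasure L w), preAct w (extParams θ) l x i = 0 →
      layerOut w (extParams θ) l x = 0 := by
  have hms : MeasurableSet {θ : Params L w | preAct w (extParams θ) l x i = 0 ∧
      layerOut w (extParams θ) l x ≠ 0} := by
    refine MeasurableSet.inter ?_ (MeasurableSet.compl ?_)
    · exact (isClosed_eq (continuous_preAct x l i) continuous_const).measurableSet
    · exact (isClosed_eq (continuous_pi fun j => continuous_layerOut x l j)
        continuous_const).measurableSet
  set B := {θ : Params L w | preAct w (extParams θ) l x i = 0 ∧
      layerOut w (extParams θ) l x ≠ 0} with hB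
  have h0 : initMeasure L w B = 0 := by
    rw [← lintegral_indicator_one hms]
    refine le_antisymm ((lintegral_initMeasure_le_of_resample (g := 0) ⟨l, hl⟩
      (measurable_one.indicator hms) fun θ => ?_).trans_eq (by simp)) zero_le
    by_cases hz : layerOut w (extParams θ) l x = 0
    · refine (lintegral_mono fun W => ?_).trans_eq (lintegral_zero)
      refine (Set.indicator_of_notMem ?_ _).le
      rintro ⟨-, h⟩
      rw [layerOut_update θ ⟨l, hl⟩ W x le_rfl] at h
      exact h hz
    · have hv : ((w l : NNReal))⁻¹ ≠ 0 := by
        obtain ⟨j, -⟩ := Function.ne_iff.mp hz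
        have : w l ≠ 0 := fun h => (Fin.cast h j).elim0
        simpa using this
      have hnull := gaussVec_hyperplane_null hv hz
      have hm : Measurable fun v : Fin (w l) → ℝ => ∑ j, v j * layerOut w (extParams θ) l x j := by
        fun_prop
      have hs : MeasurableSet {v : Fin (w l) → ℝ | ∑ j, v j * layerOut w (extParams θ) l x j = 0} :=
        hm (measurableSet_singleton 0)
      rw [Pi.zero_apply, ← hnull, ← lintegral_indicator_one hs,
        ← lintegral_pi_eval (fun _ : Fin (w (l + 1)) => gaussVec (Fin (w l)) ((w l : NNReal))⁻¹) i
          (measurable_one.indicator hs)]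
      refine lintegral_mono fun W => ?_
      by_cases hW : Function.update θ ⟨l, hl⟩ W ∈ B
      · have hWi : W i ∈ {v : Fin (w l) → ℝ | ∑ j, v j * layerOut w (extParams θ) l x j = 0} :=
          (preAct_update θ ⟨l, hl⟩ W x i).symm.trans hW.1
        rw [Set.indicator_of_mem hW, Set.indicator_of_mem hWi]
        rfl
      · rw [Set.indicator_of_notMem hW]
        exact zero_le
  filter_upwards [measure_eq_zero_iff_ae_notMem.mp h0] with θ hθ h
  by_contra hne
  exact hθ ⟨h, hne⟩

/-- Derivative of the activations of layer `k` with respect to the pre-activations of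
layer `l + 1`. -/
def jac (w : ℕ → ℕ) (θ : (l : ℕ) → Fin (w (l + 1)) → Fin (w l) → ℝ) (l : ℕ) :
    (k : ℕ) → (Fin (w 0) → ℝ) → Fin (w k) → Fin (w (l + 1)) → ℝ
  | 0, _ => 0
  | k + 1, x => fun i a => (if 0 < preAct w θ k x i then 1 else 0) *
      ((if k = l ∧ i.val = a.val then 1 else 0) + ∑ j, θ k i j * jac w θ l k x j a)

lemma jac_of_le (θ : (l : ℕ) → Fin (w (l + 1)) → Fin (w l) → ℝ) (l : ℕ) (x : Fin (w 0) → ℝ) :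
    ∀ k ≤ l, jac w θ l k x = 0
  | 0, _ => rfl
  | k + 1, hk => by
    funext i a
    simp [jac, jac_of_le θ l x k (Nat.le_of_succ_le hk), (Nat.lt_of_succ_le hk).ne]

lemma jac_congr {θ θ' : (l : ℕ) → Fin (w (l + 1)) → Fin (w l) → ℝ} (l : ℕ)
    (x : Fin (w 0) → ℝ) : ∀ {k : ℕ}, (∀ j < k, θ j = θ' j) → jac w θ l k x = jac w θ' l k x
  | 0, _ => rfl
  | k + 1, h => by
    have h' : ∀ j < k, θ j = θ' j := fun j hj => h j (hj.trans k.lt_succ_self)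
    funext i a
    have hp : preAct w θ k x i = preAct w θ' k x i := by
      simp only [preAct, layerOut_congr x h', h k k.lt_succ_self]
    simp only [jac]
    rw [hp, jac_congr l x h', h k k.lt_succ_self]

lemma measurable_jac (l : ℕ) (x : Fin (w 0) → ℝ) : ∀ (k : ℕ) (i : Fin (w k))
    (a : Fin (w (l + 1))), Measurable fun θ : Params L w => jac w (extParams θ) l k x i a
  | 0, _, _ => measurable_const
  | k + 1, i, a => by
    simp only [jac]
    refine Measurable.mul (Measurable.ite (measurableSet_lt measurable_const
      (continuous_preAct x k i).measurable) measurable_const measurable_const) ?_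
    exact measurable_const.add (Finset.measurable_fun_sum _ fun j _ =>
      (continuous_extParams k i j).measurable.mul (measurable_jac l x k j a))

/-- Gram matrix of the rows of `jac`. -/
def jacGram (w : ℕ → ℕ) (θ : (l : ℕ) → Fin (w (l + 1)) → Fin (w l) → ℝ) (l k : ℕ)
    (x x' : Fin (w 0) → ℝ) (i i' : Fin (w k)) : ℝ :=
  ∑ a, jac w θ l k x i a * jac w θ l k x' i' a

lemma measurable_jacGram (l k : ℕ) (x x' : Fin (w 0) → ℝ) (i i' : Fin (w k)) :
    Measurable fun θ : Params L w => jacGram w (extParams θ) l k x x' i i' :=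
  Finset.measurable_fun_sum _ fun a _ =>
    (measurable_jac l x k i a).mul (measurable_jac l x' k i' a)

lemma sum_lin_mul_lin {α β γ : Type*} [Fintype α] [Fintype β] [Fintype γ] (u : α → ℝ) (v : β → ℝ)
    (A : α → γ → ℝ) (B : β → γ → ℝ) :
    ∑ a, (∑ j, u j * A j a) * (∑ k, v k * B k a) =
      ∑ j, ∑ k, u j * v k * ∑ a, A j a * B k a := by
  simp only [Finset.sum_mul_sum]
  rw [Finset.sum_comm]
  refine Finset.sum_congr rfl fun j _ => ?_
  rw [Finset.sum_comm]
  refine Finset.sum_congr rfl fun k _ => ?_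
  rw [Finset.mul_sum]
  exact Finset.sum_congr rfl fun a _ => by ring

lemma jacGram_succ_sq_le (θ : (l : ℕ) → Fin (w (l + 1)) → Fin (w l) → ℝ) {l k : ℕ} (hk : l < k)
    (x x' : Fin (w 0) → ℝ) (i i' : Fin (w (k + 1))) :
    jacGram w θ l (k + 1) x x' i i' ^ 2 ≤
      (∑ j, ∑ j', θ k i j * θ k i' j' * jacGram w θ l k x x' j j') ^ 2 := by
  have h : jacGram w θ l (k + 1) x x' i i' =
      (if 0 < preAct w θ k x i then 1 else 0) * (if 0 < preAct w θ k x' i' then 1 else 0) *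
        ∑ j, ∑ j', θ k i j * θ k i' j' * jacGram w θ l k x x' j j' := by
    simp only [jacGram, jac, hk.ne', false_and, if_false, zero_add]
    rw [← sum_lin_mul_lin, Finset.mul_sum]
    exact Finset.sum_congr rfl fun a _ => by ring
  rw [h]
  split_ifs <;> simp [sq_nonneg]

lemma sum_jacGram_self_succ_sq_le (θ : (l : ℕ) → Fin (w (l + 1)) → Fin (w l) → ℝ) (l : ℕ)
    (x x' : Fin (w 0) → ℝ) :
    ∑ i, ∑ i', jacGram w θ l (l + 1) x x' i i' ^ 2 ≤ w (l + 1) := by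
  have h : ∀ i i', jacGram w θ l (l + 1) x x' i i' ^ 2 ≤ if i = i' then 1 else 0 := by
    intro i i'
    simp only [jacGram, jac, jac_of_le θ l _ l le_rfl, true_and, Pi.zero_apply, mul_zero,
      Finset.sum_const_zero, add_zero, ← Fin.ext_iff, mul_ite, mul_one, Finset.sum_ite_eq,
      Finset.mem_univ, if_true]
    split_ifs <;> simp_all
  refine (Finset.sum_le_sum fun i _ => Finset.sum_le_sum fun i' _ => h i i').trans ?_
  simp

lemma jacGram_congr {θ θ' : (l : ℕ) → Fin (w (l + 1)) → Fin (w l) → ℝ} (l : ℕ)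
    (x x' : Fin (w 0) → ℝ) {k : ℕ} (h : ∀ j < k, θ j = θ' j) :
    jacGram w θ l k x x' = jacGram w θ' l k x x' := by
  funext i i'
  simp only [jacGram, jac_congr l _ h]

lemma jacGram_update (θ : Params L w) (l : Fin L) (W : Fin (w (l + 1)) → Fin (w l) → ℝ)
    (l' : ℕ) (x x' : Fin (w 0) → ℝ) :
    jacGram w (extParams (Function.update θ l W)) l' l x x' =
      jacGram w (extParams θ) l' l x x' :=
  jacGram_congr l' x x' fun _ hj => extParams_update_of_ne θ l W hj.ne

lemma lintegral_jacGram_sq_le {M n : ℕ} (hM : M < L) (hw : ∀ k, 1 ≤ k → k ≤ M → w k = n) (l : ℕ)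
    (x x' : Fin (w 0) → ℝ) : ∀ k, l < k → k ≤ M →
    ∫⁻ θ, ENNReal.ofReal (∑ i, ∑ i', jacGram w (extParams θ) l k x x' i i' ^ 2)
      ∂(initMeasure L w) ≤ ENNReal.ofReal ((1 + gaussFourth) ^ k * n)
  | 0, h, _ => absurd h (Nat.not_lt_zero _)
  | k + 1, h, hk => by
    have h4 := gaussFourth_nonneg
    rcases (Nat.lt_succ_iff.mp h).eq_or_lt with rfl | hlk
    · calc _ ≤ ∫⁻ θ, ENNReal.ofReal n ∂(initMeasure L w) := by
            refine lintegral_mono fun θ => ENNReal.ofReal_le_ofReal ?_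
            rw [← hw (l + 1) (by omega) hk]
            exact sum_jacGram_self_succ_sq_le _ _ _ _
        _ = ENNReal.ofReal n := by simp
        _ ≤ _ := by
            refine ENNReal.ofReal_le_ofReal (le_mul_of_one_le_left (Nat.cast_nonneg _) ?_)
            exact one_le_pow₀ (by linarith)
    · have hkL : k < L := by omega
      have hmeas : Measurable fun θ : Params L w => ENNReal.ofReal
          (∑ i, ∑ i', jacGram w (extParams θ) l (k + 1) x x' i i' ^ 2) :=
        (Finset.measurable_fun_sum _ fun i _ => Finset.measurable_fun_sum _ fun i' _ =>
          (measurable_jacGram l (k + 1) x x' i i').pow_const 2).ennreal_ofReal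
      have ih := lintegral_jacGram_sq_le hM hw l x x' k hlk (by omega)
      have hr : (n : ℝ) / n ≤ 1 := div_self_le_one _
      calc _ ≤ ∫⁻ θ, ENNReal.ofReal (1 + gaussFourth) * ENNReal.ofReal
            (∑ i, ∑ i', jacGram w (extParams θ) l k x x' i i' ^ 2) ∂(initMeasure L w) := by
            refine lintegral_initMeasure_le_of_resample ⟨k, hkL⟩ hmeas fun θ => ?_
            calc _ ≤ ∫⁻ W, ENNReal.ofReal (∑ i, ∑ i', (∑ j, ∑ j', W i j * W i' j' *
                  jacGram w (extParams θ) l k x x' j j') ^ 2)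
                  ∂(gaussMat (w (k + 1)) (w k)) := by
                  refine lintegral_mono fun W => ENNReal.ofReal_le_ofReal
                    (Finset.sum_le_sum fun i _ => Finset.sum_le_sum fun i' _ => ?_)
                  refine (jacGram_succ_sq_le _ hlk x x' i i').trans_eq ?_
                  simp only [extParams_update_self θ ⟨k, hkL⟩, jacGram_update θ ⟨k, hkL⟩]
              _ ≤ _ := by
                  refine (lintegral_gaussMat_conj_sq_le _).trans ?_
                  rw [← ENNReal.ofReal_mul (by positivity)]
                  refine ENNReal.ofReal_le_ofReal (mul_le_mul_of_nonneg_right ?_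
                    (Finset.sum_nonneg fun _ _ => Finset.sum_nonneg fun _ _ => sq_nonneg _))
                  rw [hw (k + 1) (by omega) hk, hw k (by omega) (by omega)]
                  have h0 : 0 ≤ (n : ℝ) / n := by positivity
                  nlinarith
        _ ≤ _ := by
            rw [lintegral_const_mul' _ _ ENNReal.ofReal_ne_top]
            refine (mul_le_mul_right ih _).trans_eq ?_
            rw [← ENNReal.ofReal_mul (by positivity)]
            congr 1
            ring

/-- The backward part of the layer-`l` contribution to the empirical NTK of a network with
`M` hidden layers. -/
def backKer (w : ℕ → ℕ) (θ : (l : ℕ) → Fin (w (l + 1)) → Fin (w l) → ℝ) (M l : ℕ)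
    (x x' : Fin (w 0) → ℝ) (i i' : Fin (w (M + 1))) : ℝ :=
  ∑ j, ∑ j', θ M i j * θ M i' j' * jacGram w θ l M x x' j j'

lemma measurable_backKer (M l : ℕ) (x x' : Fin (w 0) → ℝ) (i i' : Fin (w (M + 1))) :
    Measurable fun θ : Params L w => backKer w (extParams θ) M l x x' i i' :=
  Finset.measurable_fun_sum _ fun j _ => Finset.measurable_fun_sum _ fun j' _ =>
    ((continuous_extParams M i j).measurable.mul (continuous_extParams M i' j').measurable).mul
      (measurable_jacGram l M x x' j j')

lemma lintegral_comp_backKer_le {M n : ℕ} (hM : M < L) (hw : ∀ k, 1 ≤ k → k ≤ M → w k = n)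
    {l : ℕ} (hl : l < M) (x x' : Fin (w 0) → ℝ)
    (F : (Fin (w (M + 1)) → Fin (w (M + 1)) → ℝ) → ℝ) (hF : Measurable F) {c : ℝ} (hc : 0 ≤ c)
    (h : ∀ G : Fin (w M) → Fin (w M) → ℝ,
      ∫⁻ W, ENNReal.ofReal (F fun i i' => ∑ j, ∑ j', W i j * W i' j' * G j j')
        ∂(gaussMat (w (M + 1)) (w M)) ≤ ENNReal.ofReal (c * ∑ j, ∑ j', G j j' ^ 2)) :
    ∫⁻ θ, ENNReal.ofReal (F (backKer w (extParams θ) M l x x')) ∂(initMeasure L w) ≤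
      ENNReal.ofReal (c * ((1 + gaussFourth) ^ M * n)) := by
  have hm : Measurable fun θ : Params L w => backKer w (extParams θ) M l x x' :=
    measurable_pi_lambda _ fun i => measurable_pi_lambda _ fun i' =>
      measurable_backKer M l x x' i i'
  calc _ ≤ ∫⁻ θ, ENNReal.ofReal c * ENNReal.ofReal
        (∑ i, ∑ i', jacGram w (extParams θ) l M x x' i i' ^ 2) ∂(initMeasure L w) := by
        refine lintegral_initMeasure_le_of_resample ⟨M, hM⟩
          (hF.comp hm).ennreal_ofReal fun θ => ?_
        rw [← ENNReal.ofReal_mul hc]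
        refine le_trans (le_of_eq (lintegral_congr fun W => ?_)) (h _)
        congr 2
        funext i i'
        simp only [backKer, extParams_update_self θ ⟨M, hM⟩, jacGram_update θ ⟨M, hM⟩]
    _ ≤ _ := by
        rw [lintegral_const_mul' _ _ ENNReal.ofReal_ne_top, ENNReal.ofReal_mul hc]
        exact mul_le_mul_right (lintegral_jacGram_sq_le hM hw l x x' M hl le_rfl) _

end Network

section GramPropagation

lemma measurable_reluKernel {ι : Type*} [Fintype ι] (v : NNReal) :
    Measurable fun ab : (ι → ℝ) × (ι → ℝ) => reluKernel v ab.1 ab.2 := by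
  have hc : Continuous fun z : ((ι → ℝ) × (ι → ℝ)) × (ι → ℝ) =>
      relu (∑ j, z.2 j * z.1.1 j) * relu (∑ j, z.2 j * z.1.2 j) := by
    have := continuous_relu
    fun_prop
  exact (hc.stronglyMeasurable.integral_prod_right' (ν := gaussVec ι v)).measurable

variable {L : ℕ} {w : ℕ → ℕ} {ν : Type*} [Fintype ν]

/-- Normalized inner product of the activations of layer `l + 1`. -/
def actGram (w : ℕ → ℕ) (θ : (l : ℕ) → Fin (w (l + 1)) → Fin (w l) → ℝ) (l : ℕ)
    (x x' : Fin (w 0) → ℝ) : ℝ :=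
  (w l : ℝ)⁻¹ * ∑ i, layerOut w θ l x i * layerOut w θ l x' i

/-- Lower bound on the Gram matrix of the layer-`l` activations, on `s`-sparse vectors. -/
def GramBound (w : ℕ → ℕ) (θ : (l : ℕ) → Fin (w (l + 1)) → Fin (w l) → ℝ) (l : ℕ)
    (xs : ν → Fin (w 0) → ℝ) (s : ℕ) (κ : ℝ) : Prop :=
  ∀ c : ν → ℝ, Sparse s c →
    κ * ∑ p, c p ^ 2 ≤ (w l : ℝ)⁻¹ * ∑ j, (∑ p, c p * layerOut w θ l (xs p) j) ^ 2

lemma sum_mul_actGram (θ : (l : ℕ) → Fin (w (l + 1)) → Fin (w l) → ℝ) (l : ℕ)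
    (xs : ν → Fin (w 0) → ℝ) (c : ν → ℝ) :
    (w l : ℝ)⁻¹ * ∑ j, (∑ p, c p * layerOut w θ l (xs p) j) ^ 2 =
      ∑ p, ∑ q, c p * c q * actGram w θ l (xs p) (xs q) := by
  rw [sum_sq_lin_comb (fun p => layerOut w θ l (xs p)) c, Finset.mul_sum]
  refine Finset.sum_congr rfl fun p _ => ?_
  rw [Finset.mul_sum]
  exact Finset.sum_congr rfl fun q _ => by unfold actGram; ring

lemma quadForm_lower_bound_of_close {H Φ : ν → ν → ℝ} {κ t : ℝ}
    (ht : Fintype.card ν * t ≤ κ / 2) (hclose : ∀ p q, |H p q - Φ p q| ≤ t) (c : ν → ℝ)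
    (hΦ : κ * ∑ p, c p ^ 2 ≤ ∑ p, ∑ q, c p * c q * Φ p q) :
    κ / 2 * ∑ p, c p ^ 2 ≤ ∑ p, ∑ q, c p * c q * H p q := by
  have h0 : 0 ≤ ∑ p, c p ^ 2 := Finset.sum_nonneg fun _ _ => sq_nonneg _
  rcases isEmpty_or_nonempty ν with he | ⟨⟨p₀⟩⟩
  · simp
  have ht0 : 0 ≤ t := (abs_nonneg _).trans (hclose p₀ p₀)
  have h1 : ∑ p, ∑ q, c p * c q * Φ p q - ∑ p, ∑ q, |c p| * |c q| * t ≤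
      ∑ p, ∑ q, c p * c q * H p q := by
    rw [← Finset.sum_sub_distrib]
    refine Finset.sum_le_sum fun p _ => ?_
    rw [← Finset.sum_sub_distrib]
    refine Finset.sum_le_sum fun q _ => ?_
    have h2 : |c p * c q * (Φ p q - H p q)| ≤ |c p| * |c q| * t := by
      rw [abs_mul, abs_mul, abs_sub_comm]
      exact mul_le_mul_of_nonneg_left (hclose p q) (by positivity)
    have h3 := (le_abs_self _).trans h2
    linarith
  have h4 : ∑ p, ∑ q, |c p| * |c q| * t = (∑ p, |c p|) ^ 2 * t := by
    rw [sq, Finset.sum_mul_sum, Finset.sum_mul]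
    exact Finset.sum_congr rfl fun p _ => (Finset.sum_mul ..).symm
  have h5 : (∑ p, |c p|) ^ 2 ≤ Fintype.card ν * ∑ p, c p ^ 2 := by
    have := sq_sum_le_card_mul_sum_sq (s := (Finset.univ : Finset ν)) (f := fun p => |c p|)
    simpa using this
  have h6 := mul_le_mul_of_nonneg_right h5 ht0
  have h7 := mul_le_mul_of_nonneg_right ht h0
  rw [h4] at h1
  linarith

lemma measure_actGram_far_le {l : ℕ} (hl : l < L) (hw : w (l + 1) ≠ 0) (x x' : Fin (w 0) → ℝ)
    {R t : ℝ} (ht : 0 < t) :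
    initMeasure L w {θ | meanSq w (extParams θ) l x ≤ R ∧ meanSq w (extParams θ) l x' ≤ R ∧
      t ≤ |actGram w (extParams θ) (l + 1) x x' - reluKernel (w l : NNReal)⁻¹
        (layerOut w (extParams θ) l x) (layerOut w (extParams θ) l x')|} ≤
      ENNReal.ofReal (gaussFourth * R ^ 2 / w (l + 1) / t ^ 2) := by
  classical
  let A : Set (Params L w) :=
    {θ | meanSq w (extParams θ) l x ≤ R ∧ meanSq w (extParams θ) l x' ≤ R}
  have hA : MeasurableSet A :=
    (measurableSet_le (continuous_meanSq x l).measurable measurable_const).inter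
      (measurableSet_le (continuous_meanSq x' l).measurable measurable_const)
  let F : Params L w → ℝ := fun θ => actGram w (extParams θ) (l + 1) x x' -
    reluKernel (w l : NNReal)⁻¹ (layerOut w (extParams θ) l x) (layerOut w (extParams θ) l x')
  have hlay : ∀ (k : ℕ) z, Measurable fun θ : Params L w => layerOut w (extParams θ) k z :=
    fun k z => (continuous_pi fun j => continuous_layerOut z k j).measurable
  have hF : Measurable F := by
    refine Measurable.sub ?_ ((measurable_reluKernel _).comp ((hlay l x).prodMk (hlay l x')))
    exact measurable_const.mul (Finset.measurable_fun_sum _ fun i _ =>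
      (continuous_layerOut x _ i).measurable.mul (continuous_layerOut x' _ i).measurable)
  have hf : Measurable (A.indicator fun θ => F θ ^ 2) := (hF.pow_const 2).indicator hA
  refine (measure_mono ?_).trans (markov_ofReal (initMeasure L w) hf (pow_pos ht 2)
    (c := gaussFourth * R ^ 2 / w (l + 1)) ?_)
  · rintro θ ⟨h1, h2, h3⟩
    rw [Set.mem_ofPred_eq, Set.indicator_of_mem (show θ ∈ A from ⟨h1, h2⟩), ← sq_abs (F θ)]
    exact pow_le_pow_left₀ ht.le h3 2
  · refine (lintegral_initMeasure_le_of_resample (g := fun _ => ENNReal.ofReal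
      (gaussFourth * R ^ 2 / w (l + 1))) ⟨l, hl⟩ hf.ennreal_ofReal fun θ => ?_).trans_eq (by simp)
    have hmem : ∀ W, Function.update θ ⟨l, hl⟩ W ∈ A ↔ θ ∈ A := fun W => by
      simp only [A, Set.mem_ofPred_eq, meanSq, layerOut_update θ ⟨l, hl⟩ W _ le_rfl]
    by_cases hθ : θ ∈ A
    · refine le_trans (le_of_eq (lintegral_congr fun W => ?_))
        (lintegral_gaussMat_gram_sub_sq_le (m := w (l + 1)) (n := w l) hw hθ.1 hθ.2)
      rw [Set.indicator_of_mem ((hmem W).mpr hθ)]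
      simp only [F, actGram, layerOut_update_succ θ ⟨l, hl⟩,
        layerOut_update θ ⟨l, hl⟩ W _ le_rfl]
    · refine (lintegral_mono fun W => ?_).trans_eq lintegral_zero |>.trans zero_le
      rw [Set.indicator_of_notMem fun h => hθ ((hmem W).mp h)]
      simp

lemma measure_not_gramBound_succ_le {l : ℕ} (hl : l < L) (hw : w (l + 1) ≠ 0)
    (xs : ν → Fin (w 0) → ℝ) (s : ℕ) {κ R t : ℝ} (ht : 0 < t) (hR : 0 < R)
    (hκt : Fintype.card ν * t ≤ κ / 2) (B : Set (Params L w))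
    (hB : ∀ θ ∉ B, (∀ p, meanSq w (extParams θ) l (xs p) ≤ R) → ∀ c : ν → ℝ, Sparse s c →
      κ * ∑ p, c p ^ 2 ≤ ∑ p, ∑ q, c p * c q * reluKernel (w l : NNReal)⁻¹
        (layerOut w (extParams θ) l (xs p)) (layerOut w (extParams θ) l (xs q))) :
    initMeasure L w {θ | ¬ GramBound w (extParams θ) (l + 1) xs s (κ / 2)} ≤
      initMeasure L w B + ENNReal.ofReal ((∑ p, (w 0 : ℝ)⁻¹ * ∑ j, xs p j ^ 2) / R) +
        ENNReal.ofReal ((Fintype.card ν) ^ 2 * (gaussFourth * R ^ 2 / w (l + 1) / t ^ 2)) := by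
  let E : ν → Set (Params L w) := fun p => {θ | R ≤ meanSq w (extParams θ) l (xs p)}
  let T : ν → ν → Set (Params L w) := fun p q => {θ | meanSq w (extParams θ) l (xs p) ≤ R ∧
    meanSq w (extParams θ) l (xs q) ≤ R ∧
      t ≤ |actGram w (extParams θ) (l + 1) (xs p) (xs q) - reluKernel (w l : NNReal)⁻¹
        (layerOut w (extParams θ) l (xs p)) (layerOut w (extParams θ) l (xs q))|}
  have hsub : {θ | ¬ GramBound w (extParams θ) (l + 1) xs s (κ / 2)} ⊆
      (B ∪ ⋃ p, E p) ∪ ⋃ p, ⋃ q, T p q := by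
    intro θ hθ
    by_contra hcon
    simp only [Set.mem_union, Set.mem_iUnion, not_or, not_exists] at hcon
    obtain ⟨⟨h1, h2⟩, h3⟩ := hcon
    have h2' : ∀ p, meanSq w (extParams θ) l (xs p) ≤ R := fun p => (not_le.mp (h2 p)).le
    refine hθ fun c hc => ?_
    rw [sum_mul_actGram]
    refine quadForm_lower_bound_of_close hκt (fun p q => ?_) c (hB θ h1 h2' c hc)
    by_contra hlt
    exact h3 p q ⟨h2' p, h2' q, (not_le.mp hlt).le⟩
  have h4 := gaussFourth_nonneg
  have hx0 : ∀ p, 0 ≤ (w 0 : ℝ)⁻¹ * ∑ j, xs p j ^ 2 := fun p =>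
    mul_nonneg (by positivity) (Finset.sum_nonneg fun _ _ => sq_nonneg _)
  refine (measure_mono hsub).trans ((measure_union_le _ _).trans (add_le_add
    ((measure_union_le _ _).trans (add_le_add le_rfl ?_)) ?_))
  · refine (measure_iUnion_fintype_le _ _).trans ?_
    rw [Finset.sum_div, ENNReal.ofReal_sum_of_nonneg fun p _ => div_nonneg (hx0 p) hR.le]
    exact Finset.sum_le_sum fun p _ => markov_ofReal _ (continuous_meanSq _ l).measurable hR
      (lintegral_meanSq_le _ l hl.le)
  · refine (measure_iUnion_fintype_le _ _).trans ((Finset.sum_le_sum fun p _ =>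
      (measure_iUnion_fintype_le _ _).trans (Finset.sum_le_sum fun q _ =>
        measure_actGram_far_le hl hw (xs p) (xs q) ht)).trans_eq ?_)
    simp only [Finset.sum_const, Finset.card_univ, nsmul_eq_mul]
    rw [← mul_assoc, ENNReal.ofReal_mul (by positivity), ENNReal.ofReal_pow (by positivity),
      ENNReal.ofReal_natCast, sq (Fintype.card ν : ENNReal)]

end GramPropagation

section Widths

variable {D n O L : ℕ}

lemma widths_hidden {k : ℕ} (h1 : 1 ≤ k) (hk : k < L) : widths D n O L k = n := by
  obtain ⟨k, rfl⟩ := Nat.exists_eq_succ_of_ne_zero (Nat.one_le_iff_ne_zero.mp h1)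
  exact if_pos hk

/-- The activation Gram matrices of layer `l` are uniformly nondegenerate on `s`-sparse vectors,
with probability arbitrarily close to one in the wide limit. -/
def GramTight (D O L : ℕ) {N : ℕ} (xs : Fin N → Fin D → ℝ) (l s : ℕ) : Prop :=
  ∀ ε : ℝ, 0 < ε → ∃ κ > 0, ∃ n₀ : ℕ, ∀ n > n₀,
    initMeasure L (widths D n O L)
      {θ | ¬ GramBound (widths D n O L) (extParams θ) l xs s κ} ≤ ENNReal.ofReal ε

lemma gramTight_succ {N l s : ℕ} (hl : l + 1 < L) (xs : Fin N → Fin D → ℝ)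
    (h : ∀ ε R : ℝ, 0 < ε → ∃ κ > 0, ∃ n₀ : ℕ, ∀ n > n₀, ∃ B : Set (Params L (widths D n O L)),
      initMeasure L (widths D n O L) B ≤ ENNReal.ofReal ε ∧
      ∀ θ ∉ B, (∀ p, meanSq (widths D n O L) (extParams θ) l (xs p) ≤ R) →
      ∀ c : Fin N → ℝ, Sparse s c →
      κ * ∑ p, c p ^ 2 ≤ ∑ p, ∑ q, c p * c q * reluKernel (widths D n O L l : NNReal)⁻¹
        (layerOut (widths D n O L) (extParams θ) l (xs p))
        (layerOut (widths D n O L) (extParams θ) l (xs q))) :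
    GramTight D O L xs (l + 1) s := by
  intro ε hε
  have h4 := gaussFourth_nonneg
  set S : ℝ := ∑ p, (D : ℝ)⁻¹ * ∑ j, xs p j ^ 2 with hS
  have hS0 : 0 ≤ S := Finset.sum_nonneg fun p _ =>
    mul_nonneg (by positivity) (Finset.sum_nonneg fun _ _ => sq_nonneg _)
  set R : ℝ := 3 * (S + 1) / ε with hR
  have hRpos : 0 < R := by positivity
  obtain ⟨κ, hκ, n₀, hn₀⟩ := h (ε / 3) R (by positivity)
  set t : ℝ := κ / (2 * (N + 1)) with htdef
  have ht : 0 < t := by positivity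
  have hκt : (Fintype.card (Fin N) : ℝ) * t ≤ κ / 2 := by
    rw [Fintype.card_fin, htdef, mul_div_assoc', div_le_div_iff₀ (by positivity) (by positivity)]
    nlinarith
  set A : ℝ := N ^ 2 * (gaussFourth * R ^ 2 / t ^ 2) with hA
  have hA0 : 0 ≤ A := by positivity
  obtain ⟨n₁, hn₁⟩ := exists_nat_ge (A / (ε / 3))
  refine ⟨κ / 2, by positivity, max n₀ n₁, fun n hn => ?_⟩
  have hn0 : n₀ < n := (le_max_left _ _).trans_lt hn
  have hn1 : n₁ < n := (le_max_right _ _).trans_lt hn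
  have hnpos : (0 : ℝ) < n := by exact_mod_cast (Nat.zero_le _).trans_lt hn0
  obtain ⟨B, hBle, hB⟩ := hn₀ n hn0
  have hwn : widths D n O L (l + 1) = n := widths_hidden (Nat.le_add_left _ _) hl
  have hmain := measure_not_gramBound_succ_le (w := widths D n O L) (Nat.lt_of_succ_lt hl)
    (by rw [hwn]; omega) xs s ht hRpos hκt B hB
  refine hmain.trans ?_
  have h1 : S / R ≤ ε / 3 := by
    rw [hR, div_le_div_iff₀ (by positivity) (by positivity), mul_div_assoc',
      mul_div_cancel_left₀ _ hε.ne']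
    linarith
  have h2 : (Fintype.card (Fin N) : ℝ) ^ 2 *
      (gaussFourth * R ^ 2 / (widths D n O L (l + 1) : ℕ) / t ^ 2) ≤ ε / 3 := by
    have h3 : A / (ε / 3) ≤ n := hn₁.trans (by exact_mod_cast hn1.le)
    rw [div_le_iff₀ (by positivity)] at h3
    rw [hwn, Fintype.card_fin]
    have : (N : ℝ) ^ 2 * (gaussFourth * R ^ 2 / n / t ^ 2) = A / n := by
      rw [hA]
      field_simp
    rw [this, div_le_iff₀ hnpos]
    linarith
  calc _ ≤ ENNReal.ofReal (ε / 3) + ENNReal.ofReal (ε / 3) + ENNReal.ofReal (ε / 3) :=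
        add_le_add (add_le_add hBle (ENNReal.ofReal_le_ofReal h1)) (ENNReal.ofReal_le_ofReal h2)
    _ = ENNReal.ofReal ε := by
        rw [← ENNReal.ofReal_add (by positivity) (by positivity),
          ← ENNReal.ofReal_add (by positivity) (by positivity)]
        congr 1
        ring

lemma gramTight_one {N s : ℕ} (hD : 0 < D) (hL : 1 < L) (xs : Fin N → Fin D → ℝ)
    (h : ∀ c : Fin N → ℝ, Sparse s c →
      (∀ g : Fin D → ℝ, ∑ p, c p * relu (∑ j, g j * xs p j) = 0) → c = 0) :
    GramTight D O L xs 1 s := by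
  have hv : ((D : NNReal))⁻¹ ≠ 0 := by simpa using hD.ne'
  obtain ⟨κ, hκ, hle⟩ := exists_reluKernel_lower_bound hv s (isCompact_singleton (x := xs))
    fun A hA c hc hz => by
      rw [Set.mem_singleton_iff] at hA
      subst hA
      exact h c hc hz
  refine gramTight_succ (l := 0) hL xs fun ε R hε => ⟨κ, hκ, 0, fun n _ => ⟨∅, by simp, ?_⟩⟩
  exact fun θ _ _ c hc => hle xs rfl c hc

lemma gramTight_succ_of_two {N l : ℕ} (hl : l + 1 < L) (xs : Fin N → Fin D → ℝ)
    (h : GramTight D O L xs l 2) : GramTight D O L xs (l + 1) N := by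
  refine gramTight_succ hl xs fun ε R hε => ?_
  obtain ⟨κ, hκ, n₀, hn₀⟩ := h ε hε
  obtain ⟨κ', hκ', hle⟩ := exists_reluKernel_lower_bound_of_pairwise hκ R (Fin N)
  refine ⟨κ', hκ', n₀, fun n hn => ⟨_, hn₀ n hn, fun θ hθ hR c _ => ?_⟩⟩
  have hθ' : GramBound (widths D n O L) (extParams θ) l xs 2 κ := not_not.mp hθ
  refine hle _ _ _ (fun p => ?_) (fun c hc => ?_) c
  · rw [coe_inv_natCast]
    exact hR p
  · rw [coe_inv_natCast]
    exact hθ' c hc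

lemma GramTight.two {N l : ℕ} {xs : Fin N → Fin D → ℝ} (h : GramTight D O L xs l N) :
    GramTight D O L xs l 2 := by
  intro ε hε
  obtain ⟨κ, hκ, n₀, hn₀⟩ := h ε hε
  refine ⟨κ, hκ, n₀, fun n hn => (measure_mono ?_).trans (hn₀ n hn)⟩
  intro θ hθ
  rw [Set.mem_ofPred_eq] at hθ ⊢
  exact fun hb => hθ fun c _ => hb c (by simpa using sparse_card c)

/-- Degeneracy of the first-layer features on sparse vectors: the obstruction to a nonsingular
limiting kernel. -/
def DegenerateInputs {D N : ℕ} (xs : Fin N → Fin D → ℝ) (s : ℕ) : Prop :=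
  ∃ c : Fin N → ℝ, c ≠ 0 ∧ Sparse s c ∧
    ∀ g : Fin D → ℝ, ∑ p, c p * relu (∑ j, g j * xs p j) = 0

lemma gramTight_last {N M : ℕ} (hD : 0 < D) (hM : 1 ≤ M) (xs : Fin N → Fin D → ℝ)
    (h : ¬ DegenerateInputs xs (if M = 1 then N else 2)) :
    GramTight D O (M + 1) xs M N := by
  have hbase := gramTight_one (O := O) (L := M + 1) hD (by omega) xs
    fun c hc hz => by_contra fun hne => h ⟨c, hne, hc, hz⟩
  split_ifs at hbase with h1
  · subst h1
    exact hbase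
  · have key : ∀ l, l + 2 ≤ M → GramTight D O (M + 1) xs (l + 2) N := by
      intro l
      induction l with
      | zero => exact fun _ => gramTight_succ_of_two (by omega) xs hbase
      | succ l ih => exact fun hl => gramTight_succ_of_two (by omega) xs (ih (by omega)).two
    obtain ⟨k, rfl⟩ : ∃ k, M = k + 2 := ⟨M - 2, by omega⟩
    exact key k le_rfl

end Widths

section Derivative

variable {L : ℕ} {w : ℕ → ℕ}

/-- No pre-activation of the first `M` layers vanishes, unless the whole layer below does. -/
def RegularAt (w : ℕ → ℕ) (θ : (l : ℕ) → Fin (w (l + 1)) → Fin (w l) → ℝ) (M : ℕ)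
    (x : Fin (w 0) → ℝ) : Prop :=
  ∀ k < M, ∀ i, preAct w θ k x i = 0 → layerOut w θ k x = 0

lemma ae_regularAt (x : Fin (w 0) → ℝ) {M : ℕ} (hM : M ≤ L) :
    ∀ᵐ θ ∂(initMeasure L w), RegularAt w (extParams θ) M x := by
  have h : ∀ᵐ θ ∂(initMeasure L w), ∀ k : Fin M, ∀ i, preAct w (extParams θ) k x i = 0 →
      layerOut w (extParams θ) k x = 0 :=
    ae_all_iff.mpr fun k => ae_all_iff.mpr fun i => ae_preAct_ne_zero x (k.2.trans_le hM) i
  filter_upwards [h] with θ hθ k hk i using hθ ⟨k, hk⟩ i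

lemma RegularAt.eventually_layerOut_eq_zero {M : ℕ} {x : Fin (w 0) → ℝ} {θ : Params L w}
    (h : RegularAt w (extParams θ) M x) : ∀ k ≤ M, ∀ i, layerOut w (extParams θ) k x i = 0 →
      ∀ᶠ θ' in nhds θ, layerOut w (extParams θ') k x i = 0
  | 0, _, _, hi => Filter.Eventually.of_forall fun _ => hi
  | k + 1, hk, i, hi => by
    have hle : preAct w (extParams θ) k x i ≤ 0 := max_eq_right_iff.mp hi
    rcases hle.lt_or_eq with hlt | heq
    · filter_upwards [(continuous_preAct x k i).continuousAt.eventually_lt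
        continuousAt_const hlt] with θ' hθ'
      exact max_eq_right hθ'.le
    · have h0 := h k hk i heq
      have hall : ∀ᶠ θ' in nhds θ, ∀ j, layerOut w (extParams θ') k x j = 0 :=
        Filter.eventually_all.mpr fun j =>
          h.eventually_layerOut_eq_zero k (Nat.le_of_succ_le hk) j (congrFun h0 j)
      filter_upwards [hall] with θ' hθ'
      simp [layerOut, hθ', relu]

/-- The coordinate direction of the weight `(l, a, b)`. -/
def weightDir (l : Fin L) (a : Fin (w (l.val + 1))) (b : Fin (w l.val)) : Params L w :=
  Pi.single l (Pi.single a (Pi.single b (1 : ℝ)))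

lemma sum_extParams_weightDir (l : Fin L) (a : Fin (w (l.val + 1))) (b : Fin (w l.val))
    (θ : (l : ℕ) → Fin (w (l + 1)) → Fin (w l) → ℝ) (x : Fin (w 0) → ℝ) (k : ℕ)
    (i : Fin (w (k + 1))) :
    ∑ j, extParams (weightDir l a b) k i j * layerOut w θ k x j =
      (if k = l.val ∧ i.val = a.val then 1 else 0) * layerOut w θ l.val x b := by
  by_cases hk : k = l.val
  · subst hk
    by_cases hi : i = a
    · subst hi
      simp [extParams, weightDir, Pi.single_apply]
    · simp [extParams, weightDir, hi, Fin.val_inj]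
  · have : extParams (weightDir l a b) k = 0 := by
      rw [extParams]
      split_ifs with h
      · exact Pi.single_eq_of_ne (fun he => hk (congrArg Fin.val he)) _
      · rfl
    simp [this, hk]

/-- The derivative of pre-activation `i` of layer `k` at backpropagation index `(l, a)`. -/
def preJac (w : ℕ → ℕ) (θ : (l : ℕ) → Fin (w (l + 1)) → Fin (w l) → ℝ) (l k : ℕ)
    (x : Fin (w 0) → ℝ) (i : Fin (w (k + 1))) (a : Fin (w (l + 1))) : ℝ :=
  (if k = l ∧ i.val = a.val then 1 else 0) + ∑ j, θ k i j * jac w θ l k x j a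

lemma exists_hasFDerivAt_preAct {k : ℕ} (hk : k < L) {x : Fin (w 0) → ℝ} {θ : Params L w}
    (h : ∀ j, ∃ T : Params L w →L[ℝ] ℝ,
      HasFDerivAt (fun θ' : Params L w => layerOut w (extParams θ') k x j) T θ ∧
      ∀ l a b, T (weightDir l a b) =
        jac w (extParams θ) l k x j a * layerOut w (extParams θ) l x b)
    (i : Fin (w (k + 1))) :
    ∃ T : Params L w →L[ℝ] ℝ,
      HasFDerivAt (fun θ' : Params L w => preAct w (extParams θ') k x i) T θ ∧
      ∀ l a b, T (weightDir l a b) =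
        preJac w (extParams θ) l k x i a * layerOut w (extParams θ) l x b := by
  choose T hT hT' using h
  let P : Fin (w k) → Params L w →L[ℝ] ℝ := fun j =>
    (ContinuousLinearMap.proj (R := ℝ) (φ := fun _ : Fin (w k) => ℝ) j).comp
      ((ContinuousLinearMap.proj (R := ℝ) (φ := fun _ : Fin (w (k + 1)) => Fin (w k) → ℝ) i).comp
        (ContinuousLinearMap.proj (R := ℝ)
          (φ := fun l : Fin L => Fin (w (l.val + 1)) → Fin (w l.val) → ℝ) ⟨k, hk⟩))
  have hP : ∀ (V : Params L w) j, P j V = extParams V k i j := fun V j => by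
    simp [P, extParams, hk]
  have hPd : ∀ j, HasFDerivAt (fun θ' : Params L w => extParams θ' k i j) (P j) θ := fun j =>
    (P j).hasFDerivAt.congr_of_eventuallyEq (Filter.Eventually.of_forall fun V => (hP V j).symm)
  refine ⟨_, HasFDerivAt.fun_sum fun j _ => (hPd j).mul (hT j), fun l a b => ?_⟩
  have hs := sum_extParams_weightDir l a b (extParams θ) x k i
  simp only [FunLike.coe_sum, Finset.sum_apply, add_apply,
    smul_apply, hP, hT', smul_eq_mul, Finset.sum_add_distrib, preJac, add_mul]
  rw [add_comm, ← hs, Finset.sum_mul]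
  congr 1
  · exact Finset.sum_congr rfl fun j _ => mul_comm _ _
  · exact Finset.sum_congr rfl fun j _ => (mul_assoc _ _ _).symm

lemma RegularAt.exists_hasFDerivAt_layerOut {M : ℕ} (hM : M ≤ L) {x : Fin (w 0) → ℝ}
    {θ : Params L w} (h : RegularAt w (extParams θ) M x) : ∀ k ≤ M, ∀ i,
      ∃ T : Params L w →L[ℝ] ℝ,
        HasFDerivAt (fun θ' : Params L w => layerOut w (extParams θ') k x i) T θ ∧
        ∀ l a b, T (weightDir l a b) =
          jac w (extParams θ) l k x i a * layerOut w (extParams θ) l x b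
  | 0, _, i => ⟨0, hasFDerivAt_const _ _, fun l a b => by simp [jac]⟩
  | k + 1, hk, i => by
    obtain ⟨T, hT, hT'⟩ := exists_hasFDerivAt_preAct (Nat.lt_of_lt_of_le hk hM)
      (h.exists_hasFDerivAt_layerOut hM k (Nat.le_of_succ_le hk)) i
    by_cases hpos : 0 < preAct w (extParams θ) k x i
    · refine ⟨T, hT.congr_of_eventuallyEq ?_, fun l a b => ?_⟩
      · filter_upwards [continuousAt_const.eventually_lt
          (continuous_preAct x k i).continuousAt hpos] with θ' hθ'
        exact max_eq_left hθ'.le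
      · simp [hT', jac, hpos, preJac]
    · refine ⟨0, (hasFDerivAt_const (0 : ℝ) θ).congr_of_eventuallyEq ?_, fun l a b => ?_⟩
      · exact h.eventually_layerOut_eq_zero (k + 1) hk i (max_eq_right (not_lt.mp hpos))
      · simp [jac, hpos]

lemma RegularAt.exists_hasFDerivAt_fnet {M : ℕ} {w : ℕ → ℕ} {x : Fin (w 0) → ℝ}
    {θ : Params (M + 1) w} (h : RegularAt w (extParams θ) M x) (i : Fin (w (M + 1))) :
    ∃ T : Params (M + 1) w →L[ℝ] ℝ,
      HasFDerivAt (fun θ' => fnet (M + 1) w θ' x i) T θ ∧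
      ∀ l a b, T (weightDir l a b) =
        preJac w (extParams θ) l M x i a * layerOut w (extParams θ) l x b :=
  exists_hasFDerivAt_preAct M.lt_succ_self
    (h.exists_hasFDerivAt_layerOut M.le_succ M le_rfl) i

lemma RegularAt.pderiv_fnet {M : ℕ} {w : ℕ → ℕ} {x : Fin (w 0) → ℝ}
    {θ : Params (M + 1) w} (h : RegularAt w (extParams θ) M x) (i : Fin (w (M + 1)))
    (l : Fin (M + 1)) (a : Fin (w (l.val + 1))) (b : Fin (w l.val)) :
    pderiv (fun θ' => fnet (M + 1) w θ' x i) θ l a b =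
      preJac w (extParams θ) l M x i a * layerOut w (extParams θ) l x b := by
  obtain ⟨T, hT, hT'⟩ := h.exists_hasFDerivAt_fnet i
  rw [pderiv, hT.fderiv]
  exact hT' l a b

lemma RegularAt.pderiv_mean_fnet {M : ℕ} {w : ℕ → ℕ} {x : Fin (w 0) → ℝ}
    {θ : Params (M + 1) w} (h : RegularAt w (extParams θ) M x) (r : ℝ)
    (l : Fin (M + 1)) (a : Fin (w (l.val + 1))) (b : Fin (w l.val)) :
    pderiv (fun θ' => r * ∑ i, fnet (M + 1) w θ' x i) θ l a b =
      r * ∑ i, pderiv (fun θ' => fnet (M + 1) w θ' x i) θ l a b := by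
  choose T hT _ using h.exists_hasFDerivAt_fnet
  rw [pderiv, ((HasFDerivAt.fun_sum fun i _ => hT i).const_mul r).fderiv]
  simp [pderiv, fun i => (hT i).fderiv]

end Derivative

section LinearAlgebra

variable {ν o ι : Type*} [Fintype ν] [Fintype o] [Fintype ι]

/-- A solution of a uniformly coercive linear system is bounded by its right-hand side. -/
lemma sum_sq_le_of_coercive (K : Matrix ι ι ℝ) {lam : ℝ} (hlam : 0 < lam)
    (hK : ∀ u : ι → ℝ, lam * ∑ i, u i ^ 2 ≤ ∑ i, u i * ∑ j, K i j * u j) (u : ι → ℝ) :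
    ∑ i, u i ^ 2 ≤ (∑ i, (∑ j, K i j * u j) ^ 2) / lam ^ 2 := by
  have hcs := Finset.sum_mul_sq_le_sq_mul_sq Finset.univ u fun i => ∑ j, K i j * u j
  have h0 : 0 ≤ ∑ i, u i ^ 2 := Finset.sum_nonneg fun _ _ => sq_nonneg _
  rw [le_div_iff₀ (by positivity)]
  rcases h0.eq_or_lt with h | h
  · rw [← h, zero_mul]
    exact Finset.sum_nonneg fun _ _ => sq_nonneg _
  · have h1 := pow_le_pow_left₀ (by positivity) (hK u) 2
    refine le_of_mul_le_mul_left ?_ h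
    nlinarith [h1.trans hcs]

lemma sq_sum_mul_le {a u : ι → ℝ} {A : ℝ} (ha : ∀ i, |a i| ≤ A) :
    (∑ i, a i * u i) ^ 2 ≤ Fintype.card ι * A ^ 2 * ∑ i, u i ^ 2 := by
  refine (Finset.sum_mul_sq_le_sq_mul_sq Finset.univ a u).trans
    (mul_le_mul_of_nonneg_right ?_ (Finset.sum_nonneg fun _ _ => sq_nonneg _))
  calc ∑ i, a i ^ 2 ≤ ∑ _i : ι, A ^ 2 := Finset.sum_le_sum fun i _ =>
        sq_abs (a i) ▸ pow_le_pow_left₀ (abs_nonneg _) (ha i) 2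
    _ = _ := by simp

variable [DecidableEq ν] [DecidableEq o]

/-- Kernel regression with a matrix-valued kernel is stable under replacing the kernel by a
scalar one which is close to it entrywise. -/
lemma kernelRegression_sub_sq_le (K : Matrix (ν × o) (ν × o) ℝ) (Kp : Matrix ν ν ℝ)
    (kx : Matrix o (ν × o) ℝ) (kp : ν → ℝ) (R : ν → o → ℝ) {lam A B : ℝ} (hlam : 0 < lam)
    (hK : ∀ u : ν × o → ℝ, lam * ∑ i, u i ^ 2 ≤ ∑ i, u i * ∑ j, K i j * u j)
    (hKp : ∀ u : ν → ℝ, lam * ∑ i, u i ^ 2 ≤ ∑ i, u i * ∑ j, Kp i j * u j)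
    (hKKp : ∀ p q, |K p q - if p.2 = q.2 then Kp p.1 q.1 else 0| ≤ A)
    (hkkp : ∀ a q, |(if a = q.2 then kp q.1 else 0) - kx a q| ≤ A)
    (hkx : ∀ a q, |kx a q| ≤ B) (hdet : IsUnit K.det) (hdetp : IsUnit Kp.det) :
    ∑ a, ((∑ j, Matrix.vecMul kp Kp⁻¹ j * R j a) -
        (kx * K⁻¹).mulVec (fun q => R q.1 q.2) a) ^ 2 ≤
      Fintype.card o * (2 * (Fintype.card (ν × o) * A ^ 2) * ((∑ p, ∑ a, R p a ^ 2) / lam ^ 2) *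
        (1 + (Fintype.card (ν × o) * B) ^ 2 / lam ^ 2)) := by
  set u : ν × o → ℝ := K⁻¹.mulVec fun q => R q.1 q.2 with hu
  set U : ν × o → ℝ := fun q => ∑ i, Kp⁻¹ q.1 i * R i q.2 with hU
  set m : ℝ := (Fintype.card (ν × o) : ℝ) with hm
  have hm0 : 0 ≤ m := by positivity
  set ρ : ℝ := ∑ p, ∑ a, R p a ^ 2 with hρ
  have hKu : ∀ p, ∑ q, K p q * u q = R p.1 p.2 := fun p => by
    have : K.mulVec u = fun q : ν × o => R q.1 q.2 := by
      rw [hu, Matrix.mulVec_mulVec, Matrix.mul_nonsing_inv _ hdet, Matrix.one_mulVec]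
    exact congrFun this p
  have hKpU : ∀ p a, ∑ q, Kp p q * U (q, a) = R p a := fun p a => by
    have : Kp.mulVec (Kp⁻¹.mulVec fun i => R i a) = fun i => R i a := by
      rw [Matrix.mulVec_mulVec, Matrix.mul_nonsing_inv _ hdetp, Matrix.one_mulVec]
    exact congrFun this p
  have hUle : ∑ q, U q ^ 2 ≤ ρ / lam ^ 2 := by
    rw [Fintype.sum_prod_type_right, show ρ = ∑ a, ∑ p, R p a ^ 2 from Finset.sum_comm,
      Finset.sum_div]
    refine Finset.sum_le_sum fun a _ => ?_
    simpa only [hKpU] using sum_sq_le_of_coercive Kp hlam hKp fun q => U (q, a)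
  have hKe : ∀ p, ∑ q, K p q * (U q - u q) =
      ∑ q, (K p q - if p.2 = q.2 then Kp p.1 q.1 else 0) * U q := fun p => by
    have h1 : ∑ q : ν × o, (if p.2 = q.2 then Kp p.1 q.1 else 0) * U q = R p.1 p.2 := by
      rw [← hKpU, Fintype.sum_prod_type]
      simp [ite_mul]
    simp only [mul_sub, sub_mul, Finset.sum_sub_distrib, hKu, h1]
  have hele : ∑ q, (U q - u q) ^ 2 ≤ m * (m * A ^ 2 * (ρ / lam ^ 2)) / lam ^ 2 := by
    refine (sum_sq_le_of_coercive K hlam hK fun q => U q - u q).trans ?_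
    refine div_le_div_of_nonneg_right ?_ (by positivity)
    calc _ ≤ ∑ _p : ν × o, m * A ^ 2 * (ρ / lam ^ 2) := Finset.sum_le_sum fun p _ => by
          rw [hKe]
          exact (sq_sum_mul_le fun q => hKKp p q).trans
            (mul_le_mul_of_nonneg_left hUle (by positivity))
      _ = _ := by simp [hm]
  have hdiff : ∀ a, (∑ j, Matrix.vecMul kp Kp⁻¹ j * R j a) -
      (kx * K⁻¹).mulVec (fun q => R q.1 q.2) a =
        ∑ q, ((if a = q.2 then kp q.1 else 0) - kx a q) * U q + ∑ q, kx a q * (U q - u q) := by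
    intro a
    have h1 : ∑ j, Matrix.vecMul kp Kp⁻¹ j * R j a = ∑ j, kp j * U (j, a) := by
      simp only [Matrix.vecMul, dotProduct, hU, Finset.sum_mul, Finset.mul_sum]
      rw [Finset.sum_comm]
      exact Finset.sum_congr rfl fun _ _ => Finset.sum_congr rfl fun _ _ => mul_assoc _ _ _
    have h2 : ∑ q : ν × o, (if a = q.2 then kp q.1 else 0) * U q = ∑ j, kp j * U (j, a) := by
      rw [Fintype.sum_prod_type]
      simp [ite_mul]
    rw [h1, ← Matrix.mulVec_mulVec, ← hu]
    simp only [mul_sub, sub_mul, Finset.sum_sub_distrib, h2, Matrix.mulVec, dotProduct]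
    ring
  have hterm : ∀ a, ((∑ j, Matrix.vecMul kp Kp⁻¹ j * R j a) -
      (kx * K⁻¹).mulVec (fun q => R q.1 q.2) a) ^ 2 ≤
        2 * (m * A ^ 2) * (ρ / lam ^ 2) * (1 + (m * B) ^ 2 / lam ^ 2) := by
    intro a
    rw [hdiff]
    refine (add_sq_le).trans ?_
    have h1 : (∑ q, ((if a = q.2 then kp q.1 else 0) - kx a q) * U q) ^ 2 ≤
        m * A ^ 2 * (ρ / lam ^ 2) :=
      (sq_sum_mul_le fun q => hkkp a q).trans (mul_le_mul_of_nonneg_left hUle (by positivity))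
    have h2 : (∑ q, kx a q * (U q - u q)) ^ 2 ≤
        m * B ^ 2 * (m * (m * A ^ 2 * (ρ / lam ^ 2)) / lam ^ 2) :=
      (sq_sum_mul_le fun q => hkx a q).trans (mul_le_mul_of_nonneg_left hele (by positivity))
    calc _ ≤ 2 * (m * A ^ 2 * (ρ / lam ^ 2) +
          m * B ^ 2 * (m * (m * A ^ 2 * (ρ / lam ^ 2)) / lam ^ 2)) := by linarith
      _ = _ := by ring
  calc _ ≤ ∑ _a : o, 2 * (m * A ^ 2) * (ρ / lam ^ 2) * (1 + (m * B) ^ 2 / lam ^ 2) :=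
        Finset.sum_le_sum fun a _ => hterm a
    _ = _ := by simp

end LinearAlgebra

section Kernel

variable {M : ℕ} {w : ℕ → ℕ}

/-- The gradient of output `i` of a network with `M` hidden layers at a regular parameter. -/
def netGrad (w : ℕ → ℕ) (θ : (l : ℕ) → Fin (w (l + 1)) → Fin (w l) → ℝ) (M : ℕ)
    (x : Fin (w 0) → ℝ) (i : Fin (w (M + 1)))
    (t : (l : Fin (M + 1)) × Fin (w (l.val + 1)) × Fin (w l.val)) : ℝ :=
  preJac w θ t.1 M x i t.2.1 * layerOut w θ t.1 x t.2.2

lemma eNTK_eq_sum_netGrad {θ : Params (M + 1) w} {x x' : Fin (w 0) → ℝ}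
    (h : RegularAt w (extParams θ) M x) (h' : RegularAt w (extParams θ) M x')
    (i i' : Fin (w (M + 1))) :
    eNTK (M + 1) w θ x x' i i' =
      ∑ t, netGrad w (extParams θ) M x i t * netGrad w (extParams θ) M x' i' t := by
  simp only [eNTK, h.pderiv_fnet, h'.pderiv_fnet, Fintype.sum_sigma, Fintype.sum_prod_type,
    netGrad]

lemma pNTK_eq_sum_eNTK {θ : Params (M + 1) w} {x x' : Fin (w 0) → ℝ}
    (h : RegularAt w (extParams θ) M x) (h' : RegularAt w (extParams θ) M x') :
    pNTK (M + 1) w θ x x' =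
      (w (M + 1) : ℝ)⁻¹ * ∑ i, ∑ i', eNTK (M + 1) w θ x x' i i' := by
  have hr : (Real.sqrt (w (M + 1)))⁻¹ * (Real.sqrt (w (M + 1)))⁻¹ = (w (M + 1) : ℝ)⁻¹ := by
    rw [← mul_inv, Real.mul_self_sqrt (by positivity)]
  have h1 : ∀ i i', eNTK (M + 1) w θ x x' i i' =
      ∑ t : (l : Fin (M + 1)) × Fin (w (l.val + 1)) × Fin (w l.val),
        pderiv (fun θ' => fnet (M + 1) w θ' x i) θ t.1 t.2.1 t.2.2 *
          pderiv (fun θ' => fnet (M + 1) w θ' x' i') θ t.1 t.2.1 t.2.2 := fun i i' => by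
    simp only [eNTK, Fintype.sum_sigma, Fintype.sum_prod_type]
  have h2 : pNTK (M + 1) w θ x x' =
      ∑ t : (l : Fin (M + 1)) × Fin (w (l.val + 1)) × Fin (w l.val), (w (M + 1) : ℝ)⁻¹ *
        ((∑ i, pderiv (fun θ' => fnet (M + 1) w θ' x i) θ t.1 t.2.1 t.2.2) *
          ∑ i, pderiv (fun θ' => fnet (M + 1) w θ' x' i) θ t.1 t.2.1 t.2.2) := by
    simp only [pNTK, h.pderiv_mean_fnet, h'.pderiv_mean_fnet, Fintype.sum_sigma,
      Fintype.sum_prod_type, mul_mul_mul_comm, hr]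
  simp only [h1]
  rw [h2, ← Finset.mul_sum]
  simp only [Finset.sum_mul_sum]
  rw [Finset.sum_comm]
  congr 1
  exact Finset.sum_congr rfl fun i _ => Finset.sum_comm

/-- The kernel of the pre-activation gradients with respect to the pre-activations of layer
`l + 1`. -/
def headKer (w : ℕ → ℕ) (θ : (l : ℕ) → Fin (w (l + 1)) → Fin (w l) → ℝ) (l M : ℕ)
    (x x' : Fin (w 0) → ℝ) (i i' : Fin (w (M + 1))) : ℝ :=
  ∑ a, preJac w θ l M x i a * preJac w θ l M x' i' a

lemma preJac_self (θ : (l : ℕ) → Fin (w (l + 1)) → Fin (w l) → ℝ) (x : Fin (w 0) → ℝ)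
    (i a : Fin (w (M + 1))) : preJac w θ M M x i a = if i = a then 1 else 0 := by
  simp [preJac, jac_of_le θ M x M le_rfl, Fin.val_inj]

lemma headKer_self (θ : (l : ℕ) → Fin (w (l + 1)) → Fin (w l) → ℝ) (x x' : Fin (w 0) → ℝ)
    (i i' : Fin (w (M + 1))) : headKer w θ M M x x' i i' = if i = i' then 1 else 0 := by
  simp [headKer, preJac_self]

lemma headKer_of_lt (θ : (l : ℕ) → Fin (w (l + 1)) → Fin (w l) → ℝ) {l : ℕ} (hl : l < M)
    (x x' : Fin (w 0) → ℝ) : headKer w θ l M x x' = backKer w θ M l x x' := by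
  funext i i'
  simp only [headKer, preJac, hl.ne', false_and, if_false, zero_add, backKer, jacGram]
  exact sum_lin_mul_lin _ _ _ _

lemma eNTK_eq_sum_headKer {θ : Params (M + 1) w} {x x' : Fin (w 0) → ℝ}
    (h : RegularAt w (extParams θ) M x) (h' : RegularAt w (extParams θ) M x')
    (i i' : Fin (w (M + 1))) :
    eNTK (M + 1) w θ x x' i i' =
      ∑ l : Fin (M + 1), (∑ b, layerOut w (extParams θ) l x b * layerOut w (extParams θ) l x' b) *
        headKer w (extParams θ) l M x x' i i' := by
  rw [eNTK_eq_sum_netGrad h h', Fintype.sum_sigma]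
  refine Finset.sum_congr rfl fun l _ => ?_
  rw [Fintype.sum_prod_type, mul_comm, headKer, Finset.sum_mul_sum]
  exact Finset.sum_congr rfl fun a _ => Finset.sum_congr rfl fun b _ => mul_mul_mul_comm _ _ _ _

variable {ν : Type*} [Fintype ν]

lemma sum_mul_sum_eNTK_mul {θ : Params (M + 1) w} {xs : ν → Fin (w 0) → ℝ}
    (h : ∀ p, RegularAt w (extParams θ) M (xs p)) (u : ν × Fin (w (M + 1)) → ℝ) :
    ∑ p, u p * ∑ q, eNTK (M + 1) w θ (xs p.1) (xs q.1) p.2 q.2 * u q =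
      ∑ t, (∑ p, u p * netGrad w (extParams θ) M (xs p.1) p.2 t) ^ 2 := by
  rw [sum_sq_lin_comb (fun p : ν × Fin (w (M + 1)) =>
    netGrad w (extParams θ) M (xs p.1) p.2) u]
  refine Finset.sum_congr rfl fun p _ => ?_
  rw [Finset.mul_sum]
  refine Finset.sum_congr rfl fun q _ => ?_
  rw [eNTK_eq_sum_netGrad (h _) (h _)]
  ring

lemma eNTK_coercive {θ : Params (M + 1) w} {xs : ν → Fin (w 0) → ℝ}
    (h : ∀ p, RegularAt w (extParams θ) M (xs p)) {lam : ℝ}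
    (hlam : ∀ c : ν → ℝ, lam * ∑ p, c p ^ 2 ≤
      ∑ b, (∑ p, c p * layerOut w (extParams θ) M (xs p) b) ^ 2)
    (u : ν × Fin (w (M + 1)) → ℝ) :
    lam * ∑ p, u p ^ 2 ≤
      ∑ p, u p * ∑ q, eNTK (M + 1) w θ (xs p.1) (xs q.1) p.2 q.2 * u q := by
  rw [sum_mul_sum_eNTK_mul h, Fintype.sum_sigma]
  refine le_trans ?_ (Finset.single_le_sum (fun l _ => Finset.sum_nonneg fun _ _ => sq_nonneg _)
    (Finset.mem_univ (Fin.last M)))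
  rw [Fintype.sum_prod_type_right, Finset.mul_sum, Fintype.sum_prod_type]
  refine Finset.sum_le_sum fun a _ => (hlam fun p => u (p, a)).trans (le_of_eq ?_)
  refine Finset.sum_congr rfl fun b _ => ?_
  rw [Fintype.sum_prod_type]
  refine congrArg (· ^ 2) (Finset.sum_congr rfl fun p _ => ?_)
  have h1 : ∀ i, netGrad w (extParams θ) M (xs p) i ⟨Fin.last M, (a, b)⟩ =
      (if i = a then 1 else 0) * layerOut w (extParams θ) M (xs p) b := fun i =>
    congrArg (· * _) (preJac_self (extParams θ) (xs p) i a)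
  simp [h1]

lemma pNTK_coercive (hw : 0 < w (M + 1)) {θ : Params (M + 1) w} {xs : ν → Fin (w 0) → ℝ}
    (h : ∀ p, RegularAt w (extParams θ) M (xs p)) {lam : ℝ}
    (hlam : ∀ c : ν → ℝ, lam * ∑ p, c p ^ 2 ≤
      ∑ b, (∑ p, c p * layerOut w (extParams θ) M (xs p) b) ^ 2) (c : ν → ℝ) :
    lam * ∑ p, c p ^ 2 ≤ ∑ p, c p * ∑ q, pNTK (M + 1) w θ (xs p) (xs q) * c q := by
  have hw' : (0 : ℝ) < w (M + 1) := by exact_mod_cast hw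
  have h1 := eNTK_coercive h hlam fun p => c p.1
  simp only [Fintype.sum_prod_type, Finset.sum_const, Finset.card_univ, Fintype.card_fin,
    nsmul_eq_mul, ← Finset.mul_sum, ← Finset.sum_mul] at h1
  refine le_of_mul_le_mul_left ?_ hw'
  calc _ = lam * (w (M + 1) * ∑ p, c p ^ 2) := by ring
    _ ≤ _ := h1
    _ = _ := by
      rw [Finset.mul_sum]
      refine Finset.sum_congr rfl fun p _ => ?_
      rw [Finset.sum_comm, mul_left_comm, Finset.mul_sum (a := (w (M + 1) : ℝ))]
      refine congrArg (c p * ·) (Finset.sum_congr rfl fun q _ => ?_)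
      rw [pNTK_eq_sum_eNTK (h p) (h q), ← Finset.sum_mul, mul_assoc, mul_inv_cancel_left₀ hw'.ne']

lemma det_eNTK_eq_zero [DecidableEq ν] (hw : 0 < w (M + 1)) {θ : Params (M + 1) w}
    {xs : ν → Fin (w 0) → ℝ} (h : ∀ p, RegularAt w (extParams θ) M (xs p)) {d : ν → ℝ}
    (hd : d ≠ 0) (hf : ∀ (θ' : Params (M + 1) w) i, ∑ p, d p * fnet (M + 1) w θ' (xs p) i = 0) :
    Matrix.det (fun p q : ν × Fin (w (M + 1)) =>
      eNTK (M + 1) w θ (xs p.1) (xs q.1) p.2 q.2) = 0 := by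
  let i₀ : Fin (w (M + 1)) := ⟨0, hw⟩
  have hder : ∀ l a b, ∑ p, d p * pderiv (fun θ' => fnet (M + 1) w θ' (xs p) i₀) θ l a b = 0 := by
    intro l a b
    choose T hT _ using fun p => (h p).exists_hasFDerivAt_fnet i₀
    have h1 := (HasFDerivAt.fun_sum fun p (_ : p ∈ Finset.univ) => (hT p).const_mul (d p)).fderiv
    simp only [hf] at h1
    have h2 := congrArg (fun S : Params (M + 1) w →L[ℝ] ℝ => S (weightDir l a b)) h1
    simpa [pderiv, fun p => (hT p).fderiv, weightDir, eq_comm] using h2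
  refine Matrix.exists_mulVec_eq_zero_iff.mp ⟨fun q => if q.2 = i₀ then d q.1 else 0, ?_, ?_⟩
  · obtain ⟨p, hp⟩ := Function.ne_iff.mp hd
    exact Function.ne_iff.mpr ⟨(p, i₀), by simpa using hp⟩
  · funext p
    simp only [Matrix.mulVec, dotProduct, Fintype.sum_prod_type, mul_ite, mul_zero,
      Finset.sum_ite_eq', Finset.mem_univ, if_true, Pi.zero_apply, eNTK, Finset.sum_mul]
    rw [Finset.sum_comm]
    refine Finset.sum_eq_zero fun l _ => ?_
    rw [Finset.sum_comm]
    refine Finset.sum_eq_zero fun a _ => ?_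
    rw [Finset.sum_comm]
    refine Finset.sum_eq_zero fun b _ => ?_
    have h3 := hder l a b
    calc _ = pderiv (fun θ' => fnet (M + 1) w θ' (xs p.1) p.2) θ l a b *
          ∑ p, d p * pderiv (fun θ' => fnet (M + 1) w θ' (xs p) i₀) θ l a b := by
          rw [Finset.mul_sum]
          exact Finset.sum_congr rfl fun q _ => by ring
      _ = 0 := by rw [h3, mul_zero]

end Kernel

section Degenerate

lemma exists_relu_proportional {ν : Type*} [Fintype ν] [DecidableEq ν] {D : ℕ}
    {xs : ν → Fin D → ℝ} {c : ν → ℝ} (hc : c ≠ 0) (hs : Sparse 2 c)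
    (h : ∀ g : Fin D → ℝ, ∑ p, c p * relu (∑ j, g j * xs p j) = 0) :
    ∃ (p q : ν) (α β : ℝ), 0 < α ∧ 0 ≤ β ∧ (q ≠ p ∨ β = 0) ∧
      ∀ g : Fin D → ℝ, α * relu (∑ j, g j * xs p j) = β * relu (∑ j, g j * xs q j) := by
  obtain ⟨T, hT, hT0⟩ := hs
  obtain ⟨p, hp⟩ := Function.ne_iff.mp hc
  have hpT : p ∈ T := by_contra fun hn => hp (hT0 p hn)
  have hcard : (T.erase p).card ≤ 1 := by
    rw [Finset.card_erase_of_mem hpT]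
    omega
  have hsum : ∀ g : Fin D → ℝ, ∑ q ∈ T, c q * relu (∑ j, g j * xs q j) = 0 := fun g => by
    rw [← h g]
    exact Finset.sum_subset (Finset.subset_univ _) fun q _ hq => by rw [hT0 q hq, zero_mul]
  have hsum' : ∀ g : Fin D → ℝ, c p * relu (∑ j, g j * xs p j) +
      ∑ q ∈ T.erase p, c q * relu (∑ j, g j * xs q j) = 0 := fun g => by
    rw [Finset.add_sum_erase _ (fun q => c q * relu (∑ j, g j * xs q j)) hpT]
    exact hsum g
  rcases (Nat.le_one_iff_eq_zero_or_eq_one.mp hcard) with h0 | h1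
  · refine ⟨p, p, |c p|, 0, abs_pos.mpr hp, le_rfl, Or.inr rfl, fun g => ?_⟩
    have h2 := hsum' g
    rw [Finset.card_eq_zero.mp h0, Finset.sum_empty, add_zero, mul_eq_zero] at h2
    simp [h2.resolve_left hp]
  · obtain ⟨q, hq⟩ := Finset.card_eq_one.mp h1
    have hqp : q ≠ p := Finset.ne_of_mem_erase (hq ▸ Finset.mem_singleton_self q)
    refine ⟨p, q, |c p|, |c q|, abs_pos.mpr hp, abs_nonneg _, Or.inl hqp, fun g => ?_⟩
    have h2 := hsum' g
    rw [hq, Finset.sum_singleton] at h2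
    rw [← abs_of_nonneg (relu_nonneg (∑ j, g j * xs p j)),
      ← abs_of_nonneg (relu_nonneg (∑ j, g j * xs q j)), ← abs_mul, ← abs_mul,
      eq_neg_of_add_eq_zero_left h2, abs_neg]

lemma layerOut_proportional {w : ℕ → ℕ} {x x' : Fin (w 0) → ℝ} {α β : ℝ} (hα : 0 ≤ α)
    (hβ : 0 ≤ β) (h : ∀ g : Fin (w 0) → ℝ,
      α * relu (∑ j, g j * x j) = β * relu (∑ j, g j * x' j))
    (θ : (l : ℕ) → Fin (w (l + 1)) → Fin (w l) → ℝ) :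
    ∀ k i, α * layerOut w θ (k + 1) x i = β * layerOut w θ (k + 1) x' i
  | 0, i => h (θ 0 i)
  | k + 1, i => by
    have ih := layerOut_proportional hα hβ h θ k
    show α * relu (∑ j, θ (k + 1) i j * layerOut w θ (k + 1) x j) =
      β * relu (∑ j, θ (k + 1) i j * layerOut w θ (k + 1) x' j)
    rw [← relu_mul_of_nonneg hα, ← relu_mul_of_nonneg hβ, Finset.mul_sum, Finset.mul_sum]
    simp only [mul_left_comm _ (θ (k + 1) i _), ih]

lemma DegenerateInputs.exists_sum_fnet_eq_zero {w : ℕ → ℕ} {N M : ℕ} (hM : 1 ≤ M)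
    {xs : Fin N → Fin (w 0) → ℝ} (h : DegenerateInputs xs (if M = 1 then N else 2)) :
    ∃ d : Fin N → ℝ, d ≠ 0 ∧ ∀ (θ : Params (M + 1) w) i,
      ∑ p, d p * fnet (M + 1) w θ (xs p) i = 0 := by
  have key : ∀ d : Fin N → ℝ,
      (∀ θ : Params (M + 1) w, ∀ j, ∑ p, d p * layerOut w (extParams θ) M (xs p) j = 0) →
      ∀ (θ : Params (M + 1) w) i, ∑ p, d p * fnet (M + 1) w θ (xs p) i = 0 := by
    intro d hd θ i
    simp only [fnet, netOut, Finset.mul_sum]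
    rw [Finset.sum_comm]
    refine Finset.sum_eq_zero fun j _ => ?_
    simp only [mul_left_comm (d _), ← Finset.mul_sum, hd, mul_zero]
  obtain ⟨c, hc, hs, hz⟩ := h
  split_ifs at hs with h1
  · subst h1
    exact ⟨c, hc, key c fun θ j => hz _⟩
  · obtain ⟨p, q, α, β, hα, hβ, hpq, hr⟩ := exists_relu_proportional hc hs hz
    obtain ⟨k, rfl⟩ := Nat.exists_eq_succ_of_ne_zero (Nat.one_le_iff_ne_zero.mp hM)
    refine ⟨Pi.single p α - Pi.single q β, Function.ne_iff.mpr ⟨p, ?_⟩, key _ fun θ j => ?_⟩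
    · rcases hpq with h2 | rfl
      · simpa [Pi.single_eq_of_ne h2.symm] using hα.ne'
      · simpa using hα.ne'
    · have h3 := layerOut_proportional hα.le hβ hr (extParams θ) k j
      simpa [sub_mul, Finset.sum_sub_distrib, Pi.single_apply, sub_eq_zero] using h3

end Degenerate

section Tight

variable {D O L : ℕ}

/-- The property `P Q n` of the width-`n` network holds with probability arbitrarily close to
one, for all large parameters `Q` and all large widths `n`. -/
def Tight (D O L : ℕ) (P : ℝ → (n : ℕ) → Params L (widths D n O L) → Prop) : Prop :=
  ∀ ε : ℝ, 0 < ε → ∃ (Q₀ : ℝ) (n₀ : ℕ), ∀ Q ≥ Q₀, ∀ n > n₀,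
    initMeasure L (widths D n O L) {θ | ¬ P Q n θ} ≤ ENNReal.ofReal ε

lemma Tight.forall {ι : Type*} [Finite ι]
    {P : ι → ℝ → (n : ℕ) → Params L (widths D n O L) → Prop} (h : ∀ i, Tight D O L (P i)) :
    Tight D O L fun Q n θ => ∀ i, P i Q n θ := by
  have := Fintype.ofFinite ι
  intro ε hε
  choose Q₀ n₀ hQ using fun i => h i (ε / (Fintype.card ι + 1)) (by positivity)
  obtain ⟨Q₁, hQ₁⟩ := Finite.exists_le Q₀
  obtain ⟨n₁, hn₁⟩ := Finite.exists_le n₀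
  refine ⟨Q₁, n₁, fun Q hQQ n hn => ?_⟩
  calc _ ≤ initMeasure L (widths D n O L) (⋃ i, {θ | ¬ P i Q n θ}) := by
        refine measure_mono fun θ hθ => ?_
        simpa using hθ
    _ ≤ ∑ i, initMeasure L (widths D n O L) {θ | ¬ P i Q n θ} := measure_iUnion_fintype_le _ _
    _ ≤ ∑ _i : ι, ENNReal.ofReal (ε / (Fintype.card ι + 1)) := Finset.sum_le_sum fun i _ =>
        hQ i Q ((hQ₁ i).trans hQQ) n ((hn₁ i).trans_lt hn)
    _ = ENNReal.ofReal (Fintype.card ι * (ε / (Fintype.card ι + 1))) := by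
        rw [Finset.sum_const, nsmul_eq_mul, ENNReal.ofReal_mul (by positivity),
          ENNReal.ofReal_natCast, Finset.card_univ]
    _ ≤ ENNReal.ofReal ε := ENNReal.ofReal_le_ofReal (by
        rw [mul_div_assoc', div_le_iff₀ (by positivity)]
        nlinarith)

lemma Tight.and {P P' : ℝ → (n : ℕ) → Params L (widths D n O L) → Prop}
    (h : Tight D O L P) (h' : Tight D O L P') :
    Tight D O L fun Q n θ => P Q n θ ∧ P' Q n θ := by
  intro ε hε
  obtain ⟨Q₀, n₀, h0⟩ := h (ε / 2) (by positivity)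
  obtain ⟨Q₁, n₁, h1⟩ := h' (ε / 2) (by positivity)
  refine ⟨max Q₀ Q₁, max n₀ n₁, fun Q hQ n hn => ?_⟩
  calc _ ≤ initMeasure L (widths D n O L) ({θ | ¬ P Q n θ} ∪ {θ | ¬ P' Q n θ}) := by
        refine measure_mono fun θ hθ => ?_
        exact not_and_or.mp hθ
    _ ≤ ENNReal.ofReal (ε / 2) + ENNReal.ofReal (ε / 2) := (measure_union_le _ _).trans
        (add_le_add (h0 Q ((le_max_left _ _).trans hQ) n ((le_max_left _ _).trans_lt hn))
          (h1 Q ((le_max_right _ _).trans hQ) n ((le_max_right _ _).trans_lt hn)))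
    _ = ENNReal.ofReal ε := by
        rw [← ENNReal.ofReal_add (by positivity) (by positivity), add_halves]

lemma tight_of_ae {P : (n : ℕ) → Params L (widths D n O L) → Prop}
    (h : ∀ n, ∀ᵐ θ ∂(initMeasure L (widths D n O L)), P n θ) :
    Tight D O L fun _ n θ => P n θ :=
  fun _ _ => ⟨0, 0, fun _ _ n _ => (ae_iff.mp (h n)).trans_le zero_le⟩

lemma tight_le_of_lintegral_le (c : ℝ) (f : (n : ℕ) → Params L (widths D n O L) → ℝ)
    (hf : ∀ n, Measurable (f n))
    (h : ∀ n > 0, ∫⁻ θ, ENNReal.ofReal (f n θ) ∂(initMeasure L (widths D n O L)) ≤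
      ENNReal.ofReal c) :
    Tight D O L fun Q n θ => f n θ ≤ Q := by
  intro ε hε
  refine ⟨max 1 (c / ε), 0, fun Q hQ n hn => ?_⟩
  have hQ0 : 0 < Q := one_pos.trans_le ((le_max_left _ _).trans hQ)
  have hQ1 : c / ε ≤ Q := (le_max_right _ _).trans hQ
  refine ((measure_mono fun θ hθ => ?_).trans
    (markov_ofReal _ (hf n) hQ0 (h n hn))).trans (ENNReal.ofReal_le_ofReal ?_)
  · exact (not_le.mp hθ).le
  · rw [div_le_iff₀ hε] at hQ1
    rw [div_le_iff₀ hQ0]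
    linarith

lemma GramTight.tight {N l : ℕ} {xs : Fin N → Fin D → ℝ} (h : GramTight D O L xs l N) :
    Tight D O L fun Q n θ => GramBound (widths D n O L) (extParams θ) l xs N Q⁻¹ := by
  intro ε hε
  obtain ⟨κ, hκ, n₀, h0⟩ := h ε hε
  refine ⟨κ⁻¹, n₀, fun Q hQ n hn => (measure_mono fun θ hθ => ?_).trans (h0 n hn)⟩
  rw [Set.mem_ofPred_eq] at hθ ⊢
  refine fun hb => hθ fun c hc => le_trans (mul_le_mul_of_nonneg_right ?_
    (Finset.sum_nonneg fun _ _ => sq_nonneg _)) (hb c hc)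
  exact inv_le_of_inv_le₀ hκ hQ

end Tight

section EntrywiseBounds

lemma abs_sum_mul_le {ι : Type*} [Fintype ι] {d k : ι → ℝ} {A B : ℝ} (hd : ∀ i, |d i| ≤ A)
    (hk : ∀ i, |k i| ≤ B) : |∑ i, d i * k i| ≤ Fintype.card ι * (A * B) := by
  refine (Finset.abs_sum_le_sum_abs _ _).trans ?_
  calc ∑ i, |d i * k i| ≤ ∑ _i : ι, A * B := Finset.sum_le_sum fun i _ => by
        rw [abs_mul]
        exact mul_le_mul (hd i) (hk i) (abs_nonneg _) ((abs_nonneg _).trans (hd i))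
    _ = _ := by simp

/-- A matrix with small off-diagonal entries and almost constant diagonal is close to the scalar
matrix given by the sum of its entries divided by its size. -/
lemma abs_sub_ite_mean_le {o : Type*} [Fintype o] [DecidableEq o] {e : o → o → ℝ} {a : ℝ}
    (hoff : ∀ i i', i ≠ i' → |e i i'| ≤ a) (hdiag : ∀ i i', |e i i - e i' i'| ≤ a) (i i' : o) :
    |e i i' - if i = i' then (Fintype.card o : ℝ)⁻¹ * ∑ j, ∑ j', e j j' else 0| ≤
      (Fintype.card o + 1) * a := by
  have ha : 0 ≤ a := (abs_nonneg _).trans (hdiag i i)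
  by_cases h : i = i'
  · subst h
    have hm : (Fintype.card o : ℝ) ≠ 0 := by
      have : Nonempty o := ⟨i⟩
      exact_mod_cast Fintype.card_ne_zero
    rw [if_pos rfl]
    have h1 : e i i - (Fintype.card o : ℝ)⁻¹ * ∑ j, ∑ j', e j j' =
        ∑ j, ∑ j', (Fintype.card o : ℝ)⁻¹ * ((if j = j' then e i i else 0) - e j j') := by
      simp only [← Finset.mul_sum, Finset.sum_sub_distrib, Finset.sum_ite_eq, Finset.mem_univ,
        if_true, Finset.sum_const, Finset.card_univ, nsmul_eq_mul]
      field_simp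
    have h2 : ∀ j j', |(if j = j' then e i i else 0) - e j j'| ≤ a := fun j j' => by
      split_ifs with hj
      · subst hj
        exact hdiag i j
      · rw [zero_sub, abs_neg]
        exact hoff j j' hj
    rw [h1]
    calc _ ≤ ∑ _j : o, ∑ _j' : o, (Fintype.card o : ℝ)⁻¹ * a :=
          (Finset.abs_sum_le_sum_abs _ _).trans (Finset.sum_le_sum fun j _ =>
            (Finset.abs_sum_le_sum_abs _ _).trans (Finset.sum_le_sum fun j' _ => by
              rw [abs_mul, abs_of_nonneg (by positivity)]
              exact mul_le_mul_of_nonneg_left (h2 j j') (by positivity)))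
      _ = Fintype.card o * a := by
          simp only [Finset.sum_const, Finset.card_univ, nsmul_eq_mul]
          field_simp
      _ ≤ _ := by linarith
  · rw [if_neg h, sub_zero]
    refine (hoff i i' h).trans (le_mul_of_one_le_left ha ?_)
    linarith [Nat.cast_nonneg (α := ℝ) (Fintype.card o)]

variable {M : ℕ} {w : ℕ → ℕ}

/-- The backpropagated kernels are bounded by `√Q`, and within `√(Q / n)` of a scalar matrix. -/
def BackBound (w : ℕ → ℕ) (θ : (l : ℕ) → Fin (w (l + 1)) → Fin (w l) → ℝ) (M n : ℕ)
    (x x' : Fin (w 0) → ℝ) (Q : ℝ) : Prop :=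
  ∀ l < M, ∀ i i', backKer w θ M l x x' i i ^ 2 ≤ Q ∧ (i ≠ i' →
    n * backKer w θ M l x x' i i' ^ 2 ≤ Q ∧
      n * (backKer w θ M l x x' i i - backKer w θ M l x x' i' i') ^ 2 ≤ Q)

lemma abs_le_div_sqrt {b Q n : ℝ} (hQ : 1 ≤ Q) (hn : 0 < n) (h : n * b ^ 2 ≤ Q) :
    |b| ≤ Q / √n := by
  refine abs_le_of_sq_le_sq ?_ (by positivity)
  rw [div_pow, Real.sq_sqrt hn.le, le_div_iff₀ hn]
  nlinarith

lemma BackBound.headKer {θ : (l : ℕ) → Fin (w (l + 1)) → Fin (w l) → ℝ} {n : ℕ}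
    {x x' : Fin (w 0) → ℝ} {Q : ℝ} (h : BackBound w θ M n x x' Q) (hQ : 1 ≤ Q) (hn : 1 ≤ n)
    (l : Fin (M + 1)) (i i' : Fin (w (M + 1))) :
    |headKer w θ l M x x' i i'| ≤ Q ∧ (i ≠ i' → |headKer w θ l M x x' i i'| ≤ Q / √n) ∧
      |headKer w θ l M x x' i i - headKer w θ l M x x' i' i'| ≤ Q / √n := by
  have hn' : (1 : ℝ) ≤ n := by exact_mod_cast hn
  have hn0 : (0 : ℝ) < n := by linarith
  have hq : 0 ≤ Q / √n := by positivity
  have hqQ : Q / √n ≤ Q := div_le_self (by linarith) (Real.one_le_sqrt.mpr hn')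
  rcases (Nat.lt_succ_iff.mp l.2).lt_or_eq with hl | hl
  · rw [headKer_of_lt θ hl]
    obtain ⟨h1, h2⟩ := h l hl i i'
    by_cases hi : i = i'
    · subst hi
      refine ⟨abs_le_of_sq_le_sq (h1.trans ?_) (by linarith), fun hne => absurd rfl hne, ?_⟩
      · nlinarith
      · simpa using hq
    · obtain ⟨h3, h4⟩ := h2 hi
      have h5 := abs_le_div_sqrt hQ hn0 h3
      exact ⟨h5.trans hqQ, fun _ => h5, abs_le_div_sqrt hQ hn0 h4⟩
  · have h1 : ∀ j j', _root_.headKer w θ l M x x' j j' = if j = j' then 1 else 0 := fun j j' => by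
      rw [hl]
      exact headKer_self θ x x' j j'
    simp only [h1, if_true, sub_self, abs_zero]
    refine ⟨?_, fun hi => ?_, hq⟩
    · split_ifs <;> simp <;> linarith
    · simpa [hi] using hq

lemma abs_sum_layerOut_mul_le {θ : (l : ℕ) → Fin (w (l + 1)) → Fin (w l) → ℝ} {l : ℕ}
    {x x' : Fin (w 0) → ℝ} {Q m : ℝ} (hw : 0 < w l) (hwm : w l ≤ m)
    (h : meanSq w θ l x ≤ Q) (h' : meanSq w θ l x' ≤ Q) :
    |∑ b, layerOut w θ l x b * layerOut w θ l x' b| ≤ Q * m := by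
  have hw' : (0 : ℝ) < w l := by exact_mod_cast hw
  have hQ : 0 ≤ Q := (meanSq_nonneg _ _ _).trans h
  have hm : 0 ≤ m := hw'.le.trans hwm
  have key : ∀ z, meanSq w θ l z ≤ Q → ∑ b, layerOut w θ l z b ^ 2 ≤ Q * m := fun z hz => by
    rw [meanSq, inv_mul_le_iff₀ hw'] at hz
    nlinarith
  refine abs_le_of_sq_le_sq ?_ (by positivity)
  refine (Finset.sum_mul_sq_le_sq_mul_sq _ _ _).trans ?_
  rw [sq]
  exact mul_le_mul (key x h) (key x' h') (Finset.sum_nonneg fun _ _ => sq_nonneg _) (by positivity)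

lemma eNTK_bounds {θ : Params (M + 1) w} {x x' : Fin (w 0) → ℝ} {Q m : ℝ} {n : ℕ}
    (hr : RegularAt w (extParams θ) M x) (hr' : RegularAt w (extParams θ) M x')
    (hw : ∀ l ≤ M, 0 < w l ∧ (w l : ℝ) ≤ m * n)
    (h : ∀ l ≤ M, meanSq w (extParams θ) l x ≤ Q) (h' : ∀ l ≤ M, meanSq w (extParams θ) l x' ≤ Q)
    (hb : BackBound w (extParams θ) M n x x' Q) (hQ : 1 ≤ Q) (hn : 1 ≤ n)
    (i i' : Fin (w (M + 1))) :
    |eNTK (M + 1) w θ x x' i i'| ≤ (M + 1) * (Q ^ 2 * m) * n ∧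
      |eNTK (M + 1) w θ x x' i i' - if i = i' then pNTK (M + 1) w θ x x' else 0| ≤
        (w (M + 1) + 1) * ((M + 1) * (Q ^ 2 * m)) * √n := by
  have hn' : (0 : ℝ) < n := by exact_mod_cast hn
  have hd : ∀ l : Fin (M + 1), |∑ b, layerOut w (extParams θ) l x b *
      layerOut w (extParams θ) l x' b| ≤ Q * (m * n) := fun l =>
    abs_sum_layerOut_mul_le (hw l (Nat.lt_succ_iff.mp l.2)).1 (hw l (Nat.lt_succ_iff.mp l.2)).2
      (h l (Nat.lt_succ_iff.mp l.2)) (h' l (Nat.lt_succ_iff.mp l.2))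
  have hk := fun l => hb.headKer hQ hn l
  have hs : (n : ℝ) / √n = √n := Real.div_sqrt
  have hsmall : ((Fintype.card (Fin (M + 1)) : ℕ) : ℝ) * (Q * (m * n) * (Q / √n)) =
      (M + 1) * (Q ^ 2 * m) * √n := by
    rw [Fintype.card_fin, show (M + 1) * (Q ^ 2 * m) * √n = (M + 1) * (Q ^ 2 * m) * (n / √n) by
      rw [hs]]
    push_cast
    ring
  constructor
  · rw [eNTK_eq_sum_headKer hr hr']
    refine (abs_sum_mul_le hd fun l => (hk l i i').1).trans_eq ?_
    rw [Fintype.card_fin]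
    push_cast
    ring
  · have h1 := abs_sub_ite_mean_le (e := fun j j' => eNTK (M + 1) w θ x x' j j')
      (a := (M + 1) * (Q ^ 2 * m) * √n) (fun j j' hj => ?_) (fun j j' => ?_) i i'
    · rw [pNTK_eq_sum_eNTK hr hr', mul_assoc]
      simpa only [Fintype.card_fin] using h1
    · simp only [eNTK_eq_sum_headKer hr hr']
      exact (abs_sum_mul_le hd fun l => (hk l j j').2.1 hj).trans_eq hsmall
    · simp only [eNTK_eq_sum_headKer hr hr', ← Finset.sum_sub_distrib, ← mul_sub]
      exact (abs_sum_mul_le hd fun l => (hk l j j').2.2).trans_eq hsmall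

end EntrywiseBounds

section TightBounds

variable {D O L M : ℕ}

lemma widths_last {n : ℕ} : widths D n O (M + 1) (M + 1) = O := if_neg (lt_irrefl _)

lemma tight_meanSq (x : Fin D → ℝ) {l : ℕ} (hl : l ≤ L) :
    Tight D O L fun Q n θ => meanSq (widths D n O L) (extParams θ) l x ≤ Q :=
  tight_le_of_lintegral_le ((D : ℝ)⁻¹ * ∑ j, x j ^ 2)
    (fun n θ => meanSq (widths D n O L) (extParams θ) l x)
    (fun _ => (continuous_meanSq _ _).measurable) fun _ _ => lintegral_meanSq_le _ l hl

lemma tight_fnet (x : Fin D → ℝ) :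
    Tight D O (M + 1) fun Q n θ => ∀ i, fnet (M + 1) (widths D n O (M + 1)) θ x i ^ 2 ≤ Q := by
  have h := Tight.forall fun i : Fin O =>
    tight_le_of_lintegral_le ((D : ℝ)⁻¹ * ∑ j, x j ^ 2)
      (fun n θ => preAct (widths D n O (M + 1)) (extParams θ) M x (Fin.cast widths_last.symm i) ^ 2)
      (fun _ => ((continuous_preAct _ _ _).pow 2).measurable)
      fun _ _ => lintegral_preAct_sq_le (L := M + 1) _ M.lt_succ_self _
  intro ε hε
  obtain ⟨Q₀, n₀, h0⟩ := h ε hε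
  refine ⟨Q₀, n₀, fun Q hQ n hn => (measure_mono fun θ hθ => ?_).trans (h0 Q hQ n hn)⟩
  exact fun hb => hθ fun i => hb (Fin.cast widths_last i)

lemma tight_backKer_comp {l : ℕ} (hl : l < M) (x x' : Fin D → ℝ) {c : ℝ} (hc : 0 ≤ c)
    (F : (n : ℕ) →
      (Fin (widths D n O (M + 1) (M + 1)) → Fin (widths D n O (M + 1) (M + 1)) → ℝ) → ℝ)
    (hF : ∀ n, Measurable (F n))
    (h : ∀ n > 0, ∀ G : Fin n → Fin n → ℝ,
      ∫⁻ W, ENNReal.ofReal (F n fun i i' => ∑ j, ∑ j', W i j * W i' j' * G j j')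
        ∂(gaussMat (widths D n O (M + 1) (M + 1)) n) ≤
          ENNReal.ofReal (c * (n : ℝ)⁻¹ * ∑ j, ∑ j', G j j' ^ 2)) :
    Tight D O (M + 1) fun Q n θ =>
      F n (backKer (widths D n O (M + 1)) (extParams θ) M l x x') ≤ Q := by
  have hm : ∀ n, Measurable fun θ : Params (M + 1) (widths D n O (M + 1)) =>
      backKer (widths D n O (M + 1)) (extParams θ) M l x x' := fun n =>
    measurable_pi_lambda _ fun i => measurable_pi_lambda _ fun i' =>
      measurable_backKer (w := widths D n O (M + 1)) M l x x' i i'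
  refine tight_le_of_lintegral_le (c * (1 + gaussFourth) ^ M)
    (fun n θ => F n (backKer (widths D n O (M + 1)) (extParams θ) M l x x'))
    (fun n => (hF n).comp (hm n)) fun n hn => ?_
  have hn' : (n : ℝ) ≠ 0 := by exact_mod_cast hn.ne'
  have hwM : widths D n O (M + 1) M = n := widths_hidden (by omega) M.lt_succ_self
  have hG : ∀ k, k = n → ∀ G : Fin k → Fin k → ℝ,
      ∫⁻ W, ENNReal.ofReal (F n fun i i' => ∑ j, ∑ j', W i j * W i' j' * G j j')
        ∂(gaussMat (widths D n O (M + 1) (M + 1)) k) ≤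
          ENNReal.ofReal (c * (n : ℝ)⁻¹ * ∑ j, ∑ j', G j j' ^ 2) := by
    rintro k rfl
    exact h k hn
  refine (lintegral_comp_backKer_le (L := M + 1) (n := n) (c := c * (n : ℝ)⁻¹) M.lt_succ_self
    (fun k h1 h2 => widths_hidden h1 (Nat.lt_succ_of_le h2)) hl x x' (F n) (hF n)
    (by positivity) (hG _ hwM)).trans_eq ?_
  congr 1
  field_simp

lemma tight_backBound (x x' : Fin D → ℝ) :
    Tight D O (M + 1) fun Q n θ =>
      BackBound (widths D n O (M + 1)) (extParams θ) M n x x' Q := by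
  have h4 := gaussFourth_nonneg
  have h1 := Tight.forall fun l : Fin M => Tight.forall fun i : Fin O =>
    tight_backKer_comp (O := O) l.2 x x' h4
      (fun n B => B (Fin.cast widths_last.symm i) (Fin.cast widths_last.symm i) ^ 2)
      (fun n => by fun_prop) fun n hn G => (lintegral_gaussMat_quad_sq_le _ G).trans_eq (by
        rw [mul_assoc])
  have h2 := Tight.forall fun l : Fin M => Tight.forall fun i : Fin O =>
    Tight.forall fun i' : {i' : Fin O // i ≠ i'} =>
    tight_backKer_comp (O := O) l.2 x x' zero_le_one
      (fun n B => n * B (Fin.cast widths_last.symm i) (Fin.cast widths_last.symm i') ^ 2)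
      (fun n => by fun_prop) fun n hn G => by
        have hn' : (n : ℝ) ≠ 0 := by exact_mod_cast hn.ne'
        have hne : Fin.cast (widths_last (D := D) (n := n) (M := M)).symm i ≠
          Fin.cast widths_last.symm i'.1 := fun he => i'.2 (Fin.cast_injective _ he)
        simp only [ENNReal.ofReal_mul (Nat.cast_nonneg n)]
        rw [lintegral_const_mul' _ _ ENNReal.ofReal_ne_top, lintegral_gaussMat_bilin_sq hne G,
          ← ENNReal.ofReal_mul (Nat.cast_nonneg n)]
        refine ENNReal.ofReal_le_ofReal (le_of_eq ?_)
        field_simp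
  have h3 := Tight.forall fun l : Fin M => Tight.forall fun i : Fin O =>
    Tight.forall fun i' : {i' : Fin O // i ≠ i'} =>
    tight_backKer_comp (O := O) l.2 x x' (c := 4) (by norm_num)
      (fun n B => n * (B (Fin.cast widths_last.symm i) (Fin.cast widths_last.symm i) -
        B (Fin.cast widths_last.symm i') (Fin.cast widths_last.symm i')) ^ 2)
      (fun n => by fun_prop) fun n hn G => by
        have hn' : (n : ℝ) ≠ 0 := by exact_mod_cast hn.ne'
        have hne : Fin.cast (widths_last (D := D) (n := n) (M := M)).symm i ≠
          Fin.cast widths_last.symm i'.1 := fun he => i'.2 (Fin.cast_injective _ he)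
        simp only [ENNReal.ofReal_mul (Nat.cast_nonneg n)]
        rw [lintegral_const_mul' _ _ ENNReal.ofReal_ne_top]
        refine (mul_le_mul_right (lintegral_gaussMat_quad_diff_sq_le hne G) _).trans ?_
        rw [← ENNReal.ofReal_mul (Nat.cast_nonneg n)]
        refine ENNReal.ofReal_le_ofReal (le_of_eq ?_)
        field_simp
  intro ε hε
  obtain ⟨Q₀, n₀, h0⟩ := (h1.and (h2.and h3)) ε hε
  refine ⟨Q₀, n₀, fun Q hQ n hn => (measure_mono fun θ hθ => ?_).trans (h0 Q hQ n hn)⟩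
  rintro ⟨ha, hb, hc⟩
  refine hθ fun l hl i i' => ⟨ha ⟨l, hl⟩ (Fin.cast widths_last i), fun hi => ?_⟩
  have hi' : Fin.cast widths_last i ≠ Fin.cast widths_last i' :=
    fun he => hi (Fin.cast_injective _ he)
  exact ⟨hb ⟨l, hl⟩ _ ⟨_, hi'⟩, hc ⟨l, hl⟩ _ ⟨_, hi'⟩⟩

end TightBounds

lemma kernelRegression_pNTK_sub_eNTK_le {M N n : ℕ} {w : ℕ → ℕ} {Q m ρ : ℝ}
    (hwM : w M = n) (hwO : 0 < w (M + 1)) (hQ : 1 ≤ Q) (hn : 1 ≤ n)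
    (hw : ∀ l ≤ M, 0 < w l ∧ (w l : ℝ) ≤ m * n) {θ : Params (M + 1) w}
    {x : Fin (w 0) → ℝ} {xs : Fin N → Fin (w 0) → ℝ}
    (hr : RegularAt w (extParams θ) M x) (hrs : ∀ p, RegularAt w (extParams θ) M (xs p))
    (hx : ∀ l ≤ M, meanSq w (extParams θ) l x ≤ Q)
    (hxs : ∀ p, ∀ l ≤ M, meanSq w (extParams θ) l (xs p) ≤ Q)
    (hb : ∀ p, BackBound w (extParams θ) M n x (xs p) Q)
    (hbs : ∀ p q, BackBound w (extParams θ) M n (xs p) (xs q) Q)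
    (hg : GramBound w (extParams θ) M xs N Q⁻¹)
    (R : Fin N → Fin (w (M + 1)) → ℝ) (hR : ∀ p a, R p a ^ 2 ≤ ρ) (f : Fin (w (M + 1)) → ℝ)
    {K : Matrix (Fin N × Fin (w (M + 1))) (Fin N × Fin (w (M + 1))) ℝ}
    (hK : K = fun p q => eNTK (M + 1) w θ (xs p.1) (xs q.1) p.2 q.2)
    {kx : Matrix (Fin (w (M + 1))) (Fin N × Fin (w (M + 1))) ℝ}
    (hkx : kx = fun a q => eNTK (M + 1) w θ x (xs q.1) a q.2)
    {Kp : Matrix (Fin N) (Fin N) ℝ} (hKp : Kp = fun i j => pNTK (M + 1) w θ (xs i) (xs j))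
    {kp : Fin N → ℝ} (hkp : kp = fun j => pNTK (M + 1) w θ x (xs j))
    (hdet : IsUnit K.det) (hdetp : IsUnit Kp.det) :
    √(∑ a, ((f a + ∑ j, Matrix.vecMul kp Kp⁻¹ j * R j a) -
        (f a + (kx * K⁻¹).mulVec (fun q => R q.1 q.2) a)) ^ 2) ≤
      √(w (M + 1) * (2 * ((N * w (M + 1)) * ((w (M + 1) + 1) * ((M + 1) * (Q ^ 2 * m))) ^ 2) *
        (N * w (M + 1) * ρ * Q ^ 2) *
        (1 + ((N * w (M + 1)) * ((M + 1) * (Q ^ 2 * m)) * Q) ^ 2))) / √n := by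
  have hn0 : (0 : ℝ) < n := by exact_mod_cast hn
  have hQ0 : 0 < Q := by linarith
  set lam : ℝ := n / Q with hlam
  have hlam0 : 0 < lam := by positivity
  have hco : ∀ c : Fin N → ℝ, lam * ∑ p, c p ^ 2 ≤
      ∑ b, (∑ p, c p * layerOut w (extParams θ) M (xs p) b) ^ 2 := fun c => by
    have h1 := hg c (by simpa using sparse_card c)
    rw [show (w M : ℝ) = n by rw [hwM], le_inv_mul_iff₀ hn0] at h1
    rw [hlam, div_eq_mul_inv, mul_assoc]
    exact h1
  set A : ℝ := (w (M + 1) + 1) * ((M + 1) * (Q ^ 2 * m)) with hA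
  set B : ℝ := (M + 1) * (Q ^ 2 * m) with hB
  have hmain := kernelRegression_sub_sq_le K Kp kx kp R hlam0 (A := A * √n) (B := B * n)
    (by rw [hK]; exact eNTK_coercive hrs hco) (by rw [hKp]; exact pNTK_coercive hwO hrs hco)
    (fun p q => by
      rw [hK, hKp]
      exact (eNTK_bounds (hrs _) (hrs _) hw (hxs _) (hxs _) (hbs _ _) hQ hn _ _).2)
    (fun a q => by
      rw [hkx, hkp, abs_sub_comm]
      exact (eNTK_bounds hr (hrs _) hw hx (hxs _) (hb _) hQ hn _ _).2)
    (fun a q => by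
      rw [hkx]
      exact (eNTK_bounds hr (hrs _) hw hx (hxs _) (hb _) hQ hn _ _).1) hdet hdetp
  have hρ : ∑ p, ∑ a, R p a ^ 2 ≤ N * w (M + 1) * ρ :=
    (Finset.sum_le_sum fun p _ => Finset.sum_le_sum fun a _ => hR p a).trans_eq (by
      simp [mul_assoc])
  simp only [add_sub_add_left_eq_sub]
  rw [← Real.sqrt_div' _ hn0.le]
  refine Real.sqrt_le_sqrt (hmain.trans ?_)
  simp only [Fintype.card_prod, Fintype.card_fin, Nat.cast_mul]
  calc _ ≤ (w (M + 1) : ℝ) * (2 * ((N * w (M + 1)) * (A * √n) ^ 2) *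
        ((N * w (M + 1) * ρ) / lam ^ 2) * (1 + ((N * w (M + 1)) * (B * n)) ^ 2 / lam ^ 2)) := by
        gcongr
    _ = _ := by
        rw [mul_pow A, Real.sq_sqrt hn0.le, hlam]
        field_simp

lemma one_sub_le_measure_of_imp {Ω : Type*} [MeasurableSpace Ω] {μ : Measure Ω}
    [IsProbabilityMeasure μ] {P S : Ω → Prop} {δ : ℝ} (hδ : 0 ≤ δ)
    (hP : μ {θ | ¬ P θ} ≤ ENNReal.ofReal δ) (h : ∀ θ, P θ → S θ) :
    ENNReal.ofReal (1 - δ) ≤ μ {θ | S θ} := by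
  rw [ENNReal.ofReal_sub _ hδ, ENNReal.ofReal_one, tsub_le_iff_right]
  calc (1 : ENNReal) = μ Set.univ := measure_univ.symm
    _ ≤ μ ({θ | S θ} ∪ {θ | ¬ P θ}) := measure_mono fun θ _ =>
        (em (P θ)).imp (h θ) id
    _ ≤ _ := (measure_union_le _ _).trans (add_le_add le_rfl hP)

/-- **Theorem 3 (kernel regression with pNTK converges to kernel regression with eNTK).**
For a depth-`L` ReLU MLP with hidden widths `n` at He/fan-in initialization `θ`, a training
set `xs` of `N` points with one-hot labels (class `cls j` for point `j`), and a test input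
`x`, all in a compact set, for every `δ > 0` there are `n₀` and a constant `C` such that
for all `n > n₀`, with probability at least `1 - δ` over the initialization: whenever both
kernel Gram matrices are invertible, `‖f̂^lin(x) - f^lin(x)‖_F ≤ C n^{-1/2}`, where
`f^lin(x) = f₀(x) + Θ₀(x,𝒟) Θ₀(𝒟,𝒟)⁻¹ (𝒴 - f₀(𝒟))` uses the eNTK and
`f̂^lin(x) = f₀(x) + Θ̂₀(x,𝒟) Θ̂₀(𝒟,𝒟)⁻¹ (𝒴 - f₀(𝒟))` uses the pseudo-NTK (the residual
being reshaped as an `N × O` matrix). -/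
theorem pNTK_eNTK_kernel_regression_convergence
    (D O L N : ℕ) (hD : 0 < D) (hO : 0 < O) (hL : 2 ≤ L) (hN : 0 < N)
    (S : Set (Fin D → ℝ)) (hS : IsCompact S)
    (xs : Fin N → Fin D → ℝ) (hxs : ∀ j, xs j ∈ S)
    (cls : Fin N → Fin O)
    (x : Fin D → ℝ) (hx : x ∈ S)
    (δ : ℝ) (hδ : 0 < δ) :
    ∃ (n₀ : ℕ) (C : ℝ), ∀ n : ℕ, n₀ < n →
      ENNReal.ofReal (1 - δ) ≤
        initMeasure L (widths D n O L)
          {θ : Params L (widths D n O L) |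
            -- one-hot label matrix 𝒴_𝒟 and residual 𝒴_𝒟 - f₀(𝒟)
            let Y : Fin N → Fin (widths D n O L L) → ℝ :=
              fun j b => if (b : ℕ) = (cls j : ℕ) then 1 else 0
            let R : Fin N → Fin (widths D n O L L) → ℝ :=
              fun j b => Y j b - fnet L (widths D n O L) θ (xs j) b
            -- the NO × NO eNTK Gram matrix and the O × NO test-train block
            let K : Matrix (Fin N × Fin (widths D n O L L)) (Fin N × Fin (widths D n O L L)) ℝ :=
              fun p q => eNTK L (widths D n O L) θ (xs p.1) (xs q.1) p.2 q.2
            let kx : Matrix (Fin (widths D n O L L)) (Fin N × Fin (widths D n O L L)) ℝ :=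
              fun a q => eNTK L (widths D n O L) θ x (xs q.1) a q.2
            -- the N × N pseudo-NTK Gram matrix and the 1 × N test-train row
            let Kp : Matrix (Fin N) (Fin N) ℝ :=
              fun i j => pNTK L (widths D n O L) θ (xs i) (xs j)
            let kp : Fin N → ℝ := fun j => pNTK L (widths D n O L) θ x (xs j)
            -- linearized predictor using the eNTK
            let flin : Fin (widths D n O L L) → ℝ := fun a =>
              fnet L (widths D n O L) θ x a + (kx * K⁻¹).mulVec (fun q => R q.1 q.2) a
            -- linearized predictor using the pseudo-NTK
            let fplin : Fin (widths D n O L L) → ℝ := fun a =>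
              fnet L (widths D n O L) θ x a + ∑ j, Matrix.vecMul kp Kp⁻¹ j * R j a
            (IsUnit K.det ∧ IsUnit Kp.det) →
              Real.sqrt (∑ a, (fplin a - flin a) ^ 2) ≤ C / Real.sqrt n} := by
  obtain ⟨M, rfl⟩ := Nat.exists_eq_succ_of_ne_zero (show L ≠ 0 by omega)
  have hM : 1 ≤ M := by omega
  have hOw : ∀ n, 0 < widths D n O (M + 1) (M + 1) := fun n => by rwa [widths_last]
  by_cases hdeg : DegenerateInputs xs (if M = 1 then N else 2)
  · refine ⟨0, 0, fun n _ => one_sub_le_measure_of_imp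
      (P := fun θ => ∀ p, RegularAt (widths D n O (M + 1)) (extParams θ) M (xs p)) hδ.le ?_ ?_⟩
    · exact (ae_iff.mp (ae_all_iff.mpr fun p =>
        ae_regularAt (w := widths D n O (M + 1)) (xs p) M.le_succ)).trans_le zero_le
    · obtain ⟨d, hd, hf⟩ :=
        DegenerateInputs.exists_sum_fnet_eq_zero (w := widths D n O (M + 1)) hM hdeg
      intro θ hθ Y R K kx Kp kp flin fplin hdet
      exact absurd (det_eNTK_eq_zero (hOw n) hθ hd hf) hdet.1.ne_zero
  · let zs : Option (Fin N) → Fin D → ℝ := fun z => z.elim x xs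
    have hreg : Tight D O (M + 1) fun _ n θ =>
        ∀ z, RegularAt (widths D n O (M + 1)) (extParams θ) M (zs z) :=
      tight_of_ae fun n => ae_all_iff.mpr fun z =>
        ae_regularAt (w := widths D n O (M + 1)) (zs z) M.le_succ
    have hT := hreg.and
      ((Tight.forall fun z => Tight.forall fun l : Fin (M + 1) =>
        tight_meanSq (O := O) (zs z) l.2.le).and
      ((Tight.forall fun z => tight_fnet (O := O) (M := M) (zs z)).and
      ((Tight.forall fun z => Tight.forall fun z' =>
        tight_backBound (O := O) (M := M) (zs z) (zs z')).and
      (gramTight_last (O := O) hD hM xs hdeg).tight)))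
    obtain ⟨Q₀, n₀, h0⟩ := hT δ hδ
    set Q : ℝ := max 1 Q₀ with hQ
    have hQ1 : 1 ≤ Q := le_max_left _ _
    refine ⟨n₀, √(O * (2 * ((N * O) * ((O + 1) * ((M + 1) * (Q ^ 2 * D))) ^ 2) *
      (N * O * (2 + 2 * Q) * Q ^ 2) * (1 + ((N * O) * ((M + 1) * (Q ^ 2 * D)) * Q) ^ 2))),
      fun n hn => one_sub_le_measure_of_imp hδ.le (h0 Q (le_max_right _ _) n hn) ?_⟩
    rintro θ ⟨hreg, hms, hfn, hbb, hgb⟩ Y R K kx Kp kp flin fplin ⟨hdet, hdetp⟩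
    have hn1 : 1 ≤ n := by omega
    have hw : ∀ l ≤ M, 0 < widths D n O (M + 1) l ∧ (widths D n O (M + 1) l : ℝ) ≤ D * n := by
      intro l hl
      have hD' : (1 : ℝ) ≤ D := by exact_mod_cast hD
      have hn' : (1 : ℝ) ≤ n := by exact_mod_cast hn1
      rcases Nat.eq_zero_or_pos l with rfl | hl0
      · exact ⟨hD, le_mul_of_one_le_right (by positivity) hn'⟩
      · rw [widths_hidden hl0 (Nat.lt_succ_of_le hl)]
        exact ⟨hn1, le_mul_of_one_le_left (by positivity) hD'⟩
    have hR : ∀ p a, R p a ^ 2 ≤ 2 + 2 * Q := by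
      intro p a
      have hY : Y p a ^ 2 ≤ 1 := by
        simp only [Y]
        split_ifs <;> norm_num
      have hf : fnet (M + 1) (widths D n O (M + 1)) θ (xs p) a ^ 2 ≤ Q := hfn (some p) a
      simp only [R]
      nlinarith [sq_nonneg (Y p a + fnet (M + 1) (widths D n O (M + 1)) θ (xs p) a)]
    have hmain := kernelRegression_pNTK_sub_eNTK_le (w := widths D n O (M + 1)) (m := D)
      (widths_hidden hM M.lt_succ_self) (hOw n) hQ1 hn1 hw (hreg none) (fun p => hreg (some p))
      (fun l hl => hms none ⟨l, Nat.lt_succ_of_le hl⟩)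
      (fun p l hl => hms (some p) ⟨l, Nat.lt_succ_of_le hl⟩)
      (fun p => hbb none (some p)) (fun p q => hbb (some p) (some q)) hgb R hR
      (fnet (M + 1) (widths D n O (M + 1)) θ x) (K := K) rfl (kx := kx) rfl (Kp := Kp) rfl
      (kp := kp) rfl hdet hdetp
    rw [show (widths D n O (M + 1) (M + 1) : ℝ) = O by rw [widths_last]] at hmain
    exact hmain

end
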